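/- arXiv:1901.02289 — 5 statements merged into one kernel-verified Lean document; each statement's English description precedes it below -/
import Mathlib

section
/- Fix integers n ≥ 2, k ≥ 1, N ≥ 1. Let x̂₁, …, x̂_N ∈ ℂⁿ be distinct points, let y_1, …, y_N ∈ ℂⁿ be distinct points, and for each i = 1, …, N and 1 ≤ j ≤ k let A_{i,j} : (ℂⁿ)^j → ℂⁿ be a symmetric continuous j-multilinear map such that A_{i,1} is an invertible linear map. Then there exists a holomorphic automorphism F of ℂⁿ such that F(x̂_i) = y_i and the j-th iterated Fréchet derivative of F at x̂_i equals A_{i,j} for all i = 1, …, N and 1 ≤ j ≤ k. -/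
namespace JetInterpolation

open Filter Topology Asymptotics
open scoped ContDiff

set_option linter.unusedSectionVars false

section JetEq

variable {E F G : Type*} [NormedAddCommGroup E] [NormedSpace ℂ E]
  [NormedAddCommGroup F] [NormedSpace ℂ F] [NormedAddCommGroup G] [NormedSpace ℂ G]

/-- Two maps agree to order `k` at `p`. -/
def JetEq (k : ℕ) (f g : E → F) (p : E) : Prop :=
  (fun z => f z - g z) =o[𝓝 p] fun z => ‖z - p‖ ^ k

namespace JetEq

variable {j k : ℕ} {f g h : E → F} {p : E}

theorem refl (k : ℕ) (f : E → F) (p : E) : JetEq k f f p := by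
  simp [JetEq]

theorem symm (H : JetEq k f g p) : JetEq k g f p := by
  simpa [JetEq] using H.neg_left

theorem trans (H : JetEq k f g p) (H' : JetEq k g h p) : JetEq k f h p := by
  simpa [JetEq] using H.add H'

theorem isBigO_norm_sub_pow (p : E) (hjk : j ≤ k) :
    (fun z : E => ‖z - p‖ ^ k) =O[𝓝 p] fun z => ‖z - p‖ ^ j := by
  refine IsBigO.of_bound 1 ?_
  filter_upwards [Metric.ball_mem_nhds p one_pos] with z hz
  rw [Metric.mem_ball, dist_eq_norm] at hz
  simpa using pow_le_pow_of_le_one (norm_nonneg _) hz.le hjk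

theorem mono (H : JetEq k f g p) (hjk : j ≤ k) : JetEq j f g p :=
  H.trans_isBigO (isBigO_norm_sub_pow p hjk)

/-- A quantity which is `o(‖z - p‖ ^ k)` near `p` vanishes at `p`. -/
theorem eq_zero_of_isLittleO {X : Type*} [NormedAddCommGroup X] {u : E → X}
    (H : u =o[𝓝 p] fun z => ‖z - p‖ ^ k) : u p = 0 := by
  rw [← norm_le_zero_iff]
  refine le_of_forall_pos_le_add fun ε hε => ?_
  have h1 := (H.bound hε).self_of_nhds
  have h2 : ‖‖p - p‖ ^ k‖ ≤ 1 := by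
    rcases k with _ | k <;> simp
  nlinarith

theorem apply_eq (H : JetEq k f g p) : f p = g p :=
  sub_eq_zero.1 (eq_zero_of_isLittleO (u := fun z => f z - g z) H)

/-- Post-composition with a `C¹` map preserves agreement of jets. -/
theorem comp_left {Φ : F → G} (H : JetEq k f g p) (hΦ : ContDiff ℂ ω Φ)
    (hf : ContinuousAt f p) (hg : ContinuousAt g p) :
    JetEq k (fun z => Φ (f z)) (fun z => Φ (g z)) p := by
  obtain ⟨K, t, ht, hK⟩ := (hΦ.contDiffAt (x := f p)).of_le (m := 1) (by simp)
    |>.exists_lipschitzOnWith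
  refine IsBigO.trans_isLittleO (IsBigO.of_bound K ?_) H
  have hgp : t ∈ 𝓝 (g p) := by rwa [← H.apply_eq]
  filter_upwards [hf ht, hg hgp] with z h1 h2
  simpa [dist_eq_norm] using hK.dist_le_mul _ h1 _ h2

/-- Pre-composition with a differentiable map preserves agreement of jets. -/
theorem comp_right {Φ : G → E} {q : G} (H : JetEq k f g (Φ q)) (hΦ : DifferentiableAt ℂ Φ q) :
    JetEq k (fun z => f (Φ z)) (fun z => g (Φ z)) q := by
  refine (H.comp_tendsto hΦ.continuousAt).trans_isBigO ?_
  exact (hΦ.isBigO_sub.norm_norm).pow k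

end JetEq

/-- Cauchy estimates: the derivative of a holomorphic map vanishes to one order less. -/
theorem isLittleO_fderiv {f : E → F} {p : E} (hf : Differentiable ℂ f) {m : ℕ}
    (H : f =o[𝓝 p] fun z => ‖z - p‖ ^ (m + 1)) :
    (fderiv ℂ f) =o[𝓝 p] fun z => ‖z - p‖ ^ m := by
  have hp0 : f p = 0 := JetEq.eq_zero_of_isLittleO H
  have hdp : fderiv ℂ f p = 0 := by
    refine HasFDerivAt.fderiv (HasFDerivAt.of_isLittleO ?_)
    have := H.trans_isBigO (JetEq.isBigO_norm_sub_pow p (Nat.le_add_left 1 m))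
    simpa [hp0] using this
  refine isLittleO_iff.2 fun c hc => ?_
  obtain ⟨δ, hδ, hb⟩ := Metric.eventually_nhds_iff.1
    (isLittleO_iff.1 H (c := c / 2 ^ (m + 1)) (by positivity))
  filter_upwards [Metric.ball_mem_nhds p (half_pos hδ)] with z hz
  rw [Metric.mem_ball, dist_eq_norm] at hz
  rcases eq_or_ne z p with rfl | hzp
  · rw [hdp, norm_zero]; positivity
  set r := ‖z - p‖ with hr
  have hr0 : 0 < r := norm_pos_iff.2 (sub_ne_zero.2 hzp)
  refine ContinuousLinearMap.opNorm_le_bound _ (by positivity) fun v => ?_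
  rcases eq_or_ne v 0 with rfl | hv
  · simp
  have hv0 : 0 < ‖v‖ := norm_pos_iff.2 hv
  have hline : Differentiable ℂ fun t : ℂ => f (z + t • v) := by fun_prop
  have hder : deriv (fun t : ℂ => f (z + t • v)) 0 = fderiv ℂ f z v := by
    have h1 : HasDerivAt (fun t : ℂ => z + t • v) v 0 := by
      simpa using ((hasDerivAt_id (0 : ℂ)).smul_const v).const_add z
    have h2 : HasFDerivAt f (fderiv ℂ f z) (z + (0 : ℂ) • v) := by
      simpa using (hf z).hasFDerivAt
    exact (h2.comp_hasDerivAt (0 : ℂ) h1).deriv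
  have hC := Complex.norm_deriv_le_of_forall_mem_sphere_norm_le (c := 0) (R := r / ‖v‖)
    (C := c * r ^ (m + 1)) (by positivity) hline.diffContOnCl (fun t ht => ?_)
  · rw [hder] at hC
    calc ‖fderiv ℂ f z v‖ ≤ c * r ^ (m + 1) / (r / ‖v‖) := hC
      _ = c * ‖r ^ m‖ * ‖v‖ := by
        rw [Real.norm_of_nonneg (by positivity), pow_succ]; field_simp
  · have ht' : ‖t‖ * ‖v‖ = r := by
      rw [mem_sphere_zero_iff_norm] at ht
      rw [ht]; field_simp
    have hle : ‖z + t • v - p‖ ≤ 2 * r := by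
      calc ‖z + t • v - p‖ = ‖(z - p) + t • v‖ := by congr 1; abel
        _ ≤ ‖z - p‖ + ‖t • v‖ := norm_add_le _ _
        _ = 2 * r := by rw [norm_smul, ht']; ring
    have hlt : dist (z + t • v) p < δ := by rw [dist_eq_norm]; linarith
    calc ‖f (z + t • v)‖ ≤ c / 2 ^ (m + 1) * ‖‖z + t • v - p‖ ^ (m + 1)‖ := hb hlt
      _ ≤ c / 2 ^ (m + 1) * (2 * r) ^ (m + 1) := by
        rw [Real.norm_of_nonneg (by positivity)]; gcongr
      _ = c * r ^ (m + 1) := by rw [mul_pow]; field_simp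

theorem isLittleO_iteratedFDeriv {f : E → F} {p : E} (hf : ContDiff ℂ ω f) {k : ℕ}
    (H : f =o[𝓝 p] fun z => ‖z - p‖ ^ k) {j : ℕ} (hj : j ≤ k) :
    (iteratedFDeriv ℂ j f) =o[𝓝 p] fun z => ‖z - p‖ ^ (k - j) := by
  induction j with
  | zero =>
    refine IsBigO.trans_isLittleO (IsBigO.of_bound 1 ?_) H
    exact Eventually.of_forall fun z => by simp
  | succ j ih =>
    have h1 := ih (by omega)
    rw [show k - j = (k - (j + 1)) + 1 by omega] at h1
    have h2 := isLittleO_fderiv (hf.differentiable_iteratedFDeriv (by simp)) h1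
    refine IsBigO.trans_isLittleO (IsBigO.of_bound 1 ?_) h2
    exact Eventually.of_forall fun z => by
      rw [one_mul]; exact norm_fderiv_iteratedFDeriv.ge

theorem iteratedFDeriv_eq_zero {f : E → F} {p : E} (hf : ContDiff ℂ ω f) {k : ℕ}
    (H : f =o[𝓝 p] fun z => ‖z - p‖ ^ k) {j : ℕ} (hj : j ≤ k) :
    iteratedFDeriv ℂ j f p = 0 :=
  JetEq.eq_zero_of_isLittleO (isLittleO_iteratedFDeriv hf H hj)

theorem JetEq.iteratedFDeriv_eq {f g : E → F} {p : E} {k : ℕ} (H : JetEq k f g p)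
    (hf : ContDiff ℂ ω f) (hg : ContDiff ℂ ω g) {j : ℕ} (hj : j ≤ k) :
    iteratedFDeriv ℂ j f p = iteratedFDeriv ℂ j g p := by
  have h := iteratedFDeriv_eq_zero (hf.sub hg) H hj
  change iteratedFDeriv ℂ j (f - g) p = 0 at h
  rw [iteratedFDeriv_sub_apply (hf.of_le (by simp)).contDiffAt
    (hg.of_le (by simp)).contDiffAt] at h
  exact sub_eq_zero.1 h

/-- Leading term of a holomorphic map vanishing to order `j` at `p`. -/
theorem exists_leading_term [CompleteSpace F] {f : E → F} {p : E} (hf : ContDiff ℂ ω f) {j : ℕ}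
    (H : f =o[𝓝 p] fun z => ‖z - p‖ ^ j) :
    ∃ q : ContinuousMultilinearMap ℂ (fun _ : Fin (j + 1) => E) F,
      JetEq (j + 1) f (fun z => q fun _ => z - p) p := by
  obtain ⟨q, r, hq⟩ := (hf.contDiffAt (x := p)).analyticAt
  have hdiag : ∀ m ≤ j, ∀ y : E, q m (fun _ => y) = 0 := by
    intro m hm y
    have h := hq.iteratedFDeriv_eq_sum_of_completeSpace (n := m) (fun _ => y)
    rw [iteratedFDeriv_eq_zero hf H hm] at h
    simpa [Nat.factorial_ne_zero, Fintype.card_perm, ← Nat.cast_smul_eq_nsmul ℂ] using h.symm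
  refine ⟨q (j + 1), ?_⟩
  have h := hq.hasFPowerSeriesAt.isBigO_sub_partialSum_pow (j + 2)
  have h' := h.trans_isLittleO (k := fun y : E => ‖y‖ ^ (j + 1))
    ((isLittleO_pow_pow (by omega : j + 1 < j + 2)).comp_tendsto (tendsto_norm_zero))
  have ht : Tendsto (fun z => z - p) (𝓝 p) (𝓝 0) := by
    simpa using (continuous_id.sub continuous_const).tendsto (f := fun z : E => z - p) p
  have h'' := h'.comp_tendsto ht
  refine h''.congr_left fun z => ?_
  have hps : q.partialSum (j + 2) (z - p) = q (j + 1) fun _ => z - p := by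
    rw [FormalMultilinearSeries.partialSum, Finset.sum_range_succ, Finset.sum_eq_zero, zero_add]
    intro m hm
    exact hdiag m (by simpa [Nat.lt_succ_iff] using hm) _
  simp [hps]

/-- Replacing the argument of a homogeneous polynomial map of degree `j` by a first order
approximation changes it by `o(‖z - p‖ ^ j)`. -/
theorem isLittleO_multilinear_sub {j : ℕ} (hj : 1 ≤ j)
    (q : ContinuousMultilinearMap ℂ (fun _ : Fin j => F) G) {u w : E → F} {p : E}
    (huw : (fun z => u z - w z) =o[𝓝 p] fun z => z - p)
    (hw : w =O[𝓝 p] fun z => z - p) :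
    (fun z => q (fun _ => u z) - q (fun _ => w z)) =o[𝓝 p] fun z => ‖z - p‖ ^ j := by
  have hu : u =O[𝓝 p] fun z => z - p := by simpa using huw.isBigO.add hw
  have : Nonempty (Fin j) := ⟨⟨0, hj⟩⟩
  have h1 : (fun z => q (fun _ => u z) - q (fun _ => w z)) =O[𝓝 p]
      fun z => (‖u z‖ + ‖w z‖) ^ (j - 1) * ‖u z - w z‖ := by
    refine IsBigO.of_bound (‖q‖ * j) (Eventually.of_forall fun z => ?_)
    have := q.norm_image_sub_le (fun _ => u z) (fun _ => w z)
    rw [Fintype.card_fin] at this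
    have hsub : ((fun _ => u z) - fun _ => w z : Fin j → F) = fun _ => u z - w z := rfl
    rw [hsub, pi_norm_const, pi_norm_const, pi_norm_const] at this
    refine this.trans ?_
    rw [Real.norm_of_nonneg (by positivity), mul_assoc (‖q‖ * (j : ℝ))]
    gcongr
    exact max_le (by linarith [norm_nonneg (w z)]) (by linarith [norm_nonneg (u z)])
  refine h1.trans_isLittleO ?_
  have h2 := ((hu.norm_norm.add hw.norm_norm).pow (j - 1)).mul_isLittleO huw.norm_norm
  refine h2.congr_right fun z => ?_
  rw [← pow_succ, Nat.sub_add_cancel hj]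

theorem isBigO_multilinear {j : ℕ} (q : ContinuousMultilinearMap ℂ (fun _ : Fin j => F) G)
    {u : E → F} {p : E} (hu : u =O[𝓝 p] fun z => z - p) :
    (fun z => q fun _ => u z) =O[𝓝 p] fun z => ‖z - p‖ ^ j := by
  refine IsBigO.trans (IsBigO.of_bound ‖q‖ (Eventually.of_forall fun z => ?_)) (hu.norm_norm.pow j)
  simpa using q.le_opNorm fun _ => u z

/-- A polynomial map with prescribed derivatives at a point. -/
theorem exists_contDiff_iteratedFDeriv_eq [CompleteSpace F] (k : ℕ) (x : E) (y : F)
    (A : (j : ℕ) → ContinuousMultilinearMap ℂ (fun _ : Fin j => E) F)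
    (hA : ∀ j, 1 ≤ j → j ≤ k → ∀ (σ : Equiv.Perm (Fin j)) (v : Fin j → E),
      A j (v ∘ σ) = A j v) :
    ∃ g : E → F, ContDiff ℂ ω g ∧ g x = y ∧
      ∀ j, 1 ≤ j → j ≤ k → iteratedFDeriv ℂ j g x = A j := by
  let q : FormalMultilinearSeries ℂ E F := fun j => match j with
    | 0 => ContinuousMultilinearMap.constOfIsEmpty ℂ _ y
    | j + 1 => if j + 1 ≤ k then (((j + 1).factorial : ℂ)⁻¹) • A (j + 1) else 0
  have hqs : ∀ j, j ≠ 0 → q j = if j ≤ k then ((j.factorial : ℂ)⁻¹) • A j else 0 := by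
    rintro (_ | j) hj
    · exact absurd rfl hj
    · rfl
  have hrad : q.radius = ⊤ := by
    refine q.radius_eq_top_of_forall_image_add_eq_zero (k + 1) fun m => ?_
    exact (hqs (m + (k + 1)) (by omega)).trans (if_neg (by omega))
  have hq := q.hasFPowerSeriesOnBall (by rw [hrad]; exact ENNReal.zero_lt_top)
  have hq' : HasFPowerSeriesOnBall (fun z => q.sum (z - x)) q x q.radius := by
    simpa using hq.comp_sub x
  have han : AnalyticOnNhd ℂ (fun z => q.sum (z - x)) Set.univ := by
    have := hq'.analyticOnNhd
    rwa [hrad, Metric.eball_top] at this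
  refine ⟨fun z => q.sum (z - x), ?_, ?_, fun j hj hjk => ?_⟩
  · exact contDiff_iff_contDiffAt.2 fun z => (han z (Set.mem_univ z)).contDiffAt
  · have := hq'.coeff_zero (fun _ => 0)
    simpa [q] using this.symm
  · ext v
    rw [hq'.iteratedFDeriv_eq_sum_of_completeSpace]
    have hsum : ∀ σ : Equiv.Perm (Fin j), (q j fun i => v (σ i)) =
        ((j.factorial : ℂ)⁻¹) • A j v := fun σ => by
      rw [hqs j (by omega), if_pos hjk, smul_apply]
      congr 1
      exact hA _ hj hjk σ v
    rw [Finset.sum_congr rfl fun σ _ => hsum σ, Finset.sum_const, Finset.card_univ,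
      Fintype.card_perm, Fintype.card_fin, ← Nat.cast_smul_eq_nsmul ℂ, smul_smul,
      mul_inv_cancel₀ (by exact_mod_cast Nat.factorial_ne_zero j), one_smul]

end JetEq

section Group

variable {E : Type*} [NormedAddCommGroup E] [NormedSpace ℂ E]

/-- The group of holomorphic automorphisms of `E`. -/
def holAut (E : Type*) [NormedAddCommGroup E] [NormedSpace ℂ E] : Subgroup (Equiv.Perm E) where
  carrier := {Φ | ContDiff ℂ ω Φ ∧ ContDiff ℂ ω Φ.symm}
  mul_mem' := fun ha hb => ⟨ha.1.comp hb.1, hb.2.comp ha.2⟩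
  one_mem' := ⟨contDiff_id, contDiff_id⟩
  inv_mem' := fun h => ⟨h.2, h.1⟩

theorem differentiable_of_mem_holAut {Φ : Equiv.Perm E} (h : Φ ∈ holAut E) :
    Differentiable ℂ Φ :=
  h.1.differentiable (by simp)

/-- The automorphisms fixing `p` and agreeing with the identity to order `k` on `P`. -/
def localAut (k : ℕ) (P : Set E) (p : E) : Subgroup (Equiv.Perm E) where
  carrier := {Φ | Φ ∈ holAut E ∧ Φ p = p ∧ ∀ q ∈ P, JetEq k Φ id q}
  mul_mem' := by
    rintro Φ Ψ ⟨h1, h2, h3⟩ ⟨h1', h2', h3'⟩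
    refine ⟨mul_mem h1 h1', by simp [h2, h2'], fun q hq => ?_⟩
    have hq' : Ψ q = q := (h3' q hq).apply_eq
    exact JetEq.trans (JetEq.comp_right (f := Φ) (g := id) (Φ := Ψ) (by rw [hq']; exact h3 q hq)
      (differentiable_of_mem_holAut h1' q)) (h3' q hq)
  one_mem' := ⟨one_mem _, rfl, fun q _ => JetEq.refl k _ q⟩
  inv_mem' := by
    rintro Φ ⟨h1, h2, h3⟩
    refine ⟨inv_mem h1, by rw [Equiv.Perm.inv_eq_iff_eq, h2], fun q hq => ?_⟩
    have hq' : Φ⁻¹ q = q := by rw [Equiv.Perm.inv_eq_iff_eq, (h3 q hq).apply_eq]; rfl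
    have h4 : JetEq k (fun z => Φ (Φ⁻¹ z)) (fun z => id (Φ⁻¹ z)) q :=
      JetEq.comp_right (by rw [hq']; exact h3 q hq)
        (differentiable_of_mem_holAut (inv_mem h1) q)
    exact JetEq.symm (h4.congr_left fun z => congrArg (· - Φ⁻¹ z) (Φ.apply_symm_apply z))

/-- `Q` is a homogeneous polynomial map of degree `j` and some `Φ ∈ S` has the `j`-jet of
`z ↦ z + Q (z - p)` at `p`. -/
def IsLeadingTerm (S : Subgroup (Equiv.Perm E)) (p : E) (j : ℕ) (Q : E → E) : Prop :=
  (∃ q : ContinuousMultilinearMap ℂ (fun _ : Fin j => E) E, ∀ z, Q z = q fun _ => z) ∧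
    ∃ Φ ∈ S, JetEq j Φ (fun z => z + Q (z - p)) p

theorem isBigO_id_sub (p : E) : (fun z : E => z - p) =O[𝓝 p] fun z => z - p := isBigO_refl _ _

theorem isLittleO_pow_sub (p : E) {j : ℕ} (hj : 2 ≤ j) :
    (fun z : E => ‖z - p‖ ^ j) =o[𝓝 p] fun z => z - p := by
  have ht : Tendsto (fun z => z - p) (𝓝 p) (𝓝 0) := by
    simpa using (continuous_id.sub continuous_const).tendsto (f := fun z : E => z - p) p
  have h := (isLittleO_pow_pow (𝕜 := ℝ) (by omega : 1 < j)).comp_tendsto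
    (tendsto_norm_zero.comp ht)
  simp only [pow_one] at h
  exact h.of_norm_right

theorem IsLeadingTerm.zero {S : Subgroup (Equiv.Perm E)} {p : E} {j : ℕ} :
    IsLeadingTerm S p j 0 :=
  ⟨⟨0, fun _ => rfl⟩, 1, one_mem _, by
    simpa using! JetEq.refl j (fun z : E => z) p⟩

theorem IsLeadingTerm.add {S : Subgroup (Equiv.Perm E)} {p : E} {j : ℕ} {Q R : E → E}
    (hS : S ≤ holAut E) (hp : ∀ Φ ∈ S, Φ p = p) (hj : 2 ≤ j)
    (hQ : IsLeadingTerm S p j Q) (hR : IsLeadingTerm S p j R) :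
    IsLeadingTerm S p j (Q + R) := by
  obtain ⟨⟨q, hq⟩, Φ, hΦ, HΦ⟩ := hQ
  obtain ⟨⟨r, hr⟩, Ψ, hΨ, HΨ⟩ := hR
  refine ⟨⟨q + r, fun z => by simp [hq, hr]⟩, Φ * Ψ, mul_mem hΦ hΨ, ?_⟩
  have h1 : JetEq j (fun z => Φ (Ψ z)) (fun z => Ψ z + Q (Ψ z - p)) p :=
    JetEq.comp_right (f := Φ) (g := fun z => z + Q (z - p)) (by rw [hp Ψ hΨ]; exact HΦ)
      (differentiable_of_mem_holAut (hS hΨ) p)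
  have h2 : (fun z => (Ψ z - p) - (z - p)) =o[𝓝 p] fun z => z - p := by
    have h3 := HΨ.isBigO.add (isBigO_multilinear r (isBigO_id_sub p))
    refine (h3.congr_left (f₂ := fun z => (Ψ z - p) - (z - p)) fun z => ?_).trans_isLittleO
      (isLittleO_pow_sub p hj)
    rw [← hr]
    simp only []
    abel
  have h4 := isLittleO_multilinear_sub (by omega) q h2 (isBigO_id_sub p)
  have h5 := (h1.add HΨ).add h4
  refine h5.congr_left fun z => ?_
  simp only [Pi.add_apply, Equiv.Perm.coe_mul, Function.comp_apply, ← hq]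
  abel

theorem IsLeadingTerm.conj {S : Subgroup (Equiv.Perm E)} {p : E} {j : ℕ} {Q : E → E}
    (hS : S ≤ holAut E) (hp : ∀ Φ ∈ S, Φ p = p) (hj : 2 ≤ j)
    (hQ : IsLeadingTerm S p j Q) {Ψ : Equiv.Perm E} (hΨ : Ψ ∈ S) {L : E ≃L[ℂ] E}
    (hL : HasFDerivAt Ψ (L : E →L[ℂ] E) p) :
    IsLeadingTerm S p j (fun z => L.symm (Q (L z))) := by
  obtain ⟨⟨q, hq⟩, Φ, hΦ, HΦ⟩ := hQ
  refine ⟨⟨(L.symm : E →L[ℂ] E).compContinuousMultilinearMap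
    (q.compContinuousLinearMap fun _ => (L : E →L[ℂ] E)), fun z => ?_⟩,
    Ψ⁻¹ * Φ * Ψ, mul_mem (mul_mem (inv_mem hΨ) hΦ) hΨ, ?_⟩
  · simp [hq]
  have hΨp := hp Ψ hΨ
  have hΨd := differentiable_of_mem_holAut (hS hΨ)
  have hqd : ContDiff ℂ ω Q := by
    have : Q = fun z => q fun _ => z := funext hq
    rw [this]
    exact q.contDiff.comp (contDiff_pi.2 fun _ => contDiff_id)
  have hΨsub : (fun z => Ψ z - p) =O[𝓝 p] fun z => z - p := by
    have := hΨd.differentiableAt (x := p) |>.isBigO_sub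
    rwa [hΨp] at this
  have hQΨ : (fun z => Q (Ψ z - p)) =O[𝓝 p] fun z => ‖z - p‖ ^ j :=
    (isBigO_multilinear q hΨsub).congr_left fun z => (hq _).symm
  have hQp : Q 0 = 0 := by
    rw [hq]
    exact q.map_coord_zero ⟨0, by omega⟩ rfl
  have h1 : JetEq j (fun z => Φ (Ψ z)) (fun z => Ψ z + Q (Ψ z - p)) p :=
    JetEq.comp_right (f := Φ) (g := fun z => z + Q (z - p)) (by rw [hΨp]; exact HΦ) (hΨd p)
  have hcont : ContinuousAt (fun z => Ψ z + Q (Ψ z - p)) p :=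
    (hΨd.continuous.add (hqd.continuous.comp (hΨd.continuous.sub continuous_const))).continuousAt
  have h2 := h1.comp_left (hS hΨ).2
    ((differentiable_of_mem_holAut (hS hΦ)).continuous.comp hΨd.continuous).continuousAt hcont
  have hsd : HasStrictFDerivAt Ψ.symm (L.symm : E →L[ℂ] E) p := by
    have ha : HasFDerivAt Ψ (L : E →L[ℂ] E) (Ψ.symm p) := by
      rwa [show Ψ.symm p = p by rw [Equiv.symm_apply_eq, hΨp]]
    have hb := ha.of_local_left_inverse (g := Ψ.symm) (hS hΨ).2.continuous.continuousAt
      (Eventually.of_forall fun y => Ψ.apply_symm_apply y)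
    exact (hS hΨ).2.contDiffAt.hasStrictFDerivAt' hb (by simp)
  have ht : Tendsto (fun z => (Ψ z + Q (Ψ z - p), Ψ z)) (𝓝 p) (𝓝 (p, p)) := by
    have := (hcont.prodMk hΨd.continuous.continuousAt).tendsto
    simpa only [hΨp, sub_self, hQp, add_zero] using this
  have h3 := (hsd.isLittleO.comp_tendsto ht).trans_isBigO
    (hQΨ.congr_left (f₁ := fun z => Q (Ψ z - p)) fun z => by simp)
  have h4 : (fun z => (Ψ z - p) - L (z - p)) =o[𝓝 p] fun z => z - p := by
    have := hL.isLittleO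
    rwa [hΨp] at this
  have h5 := isLittleO_multilinear_sub (by omega) q h4 ((L : E →L[ℂ] E).isBigO_comp _ _)
  have h6 := ((L.symm : E →L[ℂ] E).isBigO_comp _ (𝓝 p)).trans_isLittleO h5
  have h7 := (h2.add h3).add h6
  refine h7.congr_left fun z => ?_
  simp only [Equiv.Perm.coe_mul, Function.comp_apply, ← hq, map_sub, map_add,
    ContinuousLinearEquiv.coe_coe, Equiv.symm_apply_apply, Equiv.Perm.inv_def]
  abel

theorem IsLeadingTerm.smul {S : Subgroup (Equiv.Perm E)} {p : E} {j : ℕ} {Q : E → E}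
    (hS : S ≤ holAut E) (hp : ∀ Φ ∈ S, Φ p = p) (hj : 2 ≤ j)
    (hlin : ∀ L : E ≃L[ℂ] E, ∃ Ψ ∈ S, HasFDerivAt Ψ (L : E →L[ℂ] E) p)
    (hQ : IsLeadingTerm S p j Q) (c : ℂ) : IsLeadingTerm S p j (c • Q) := by
  rcases eq_or_ne c 0 with rfl | hc
  · rw [zero_smul]; exact IsLeadingTerm.zero
  obtain ⟨α, hα⟩ := IsAlgClosed.exists_pow_nat_eq c (n := j - 1) (by omega)
  have hα0 : α ≠ 0 := by
    rintro rfl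
    exact hc (by rw [← hα, zero_pow (by omega)])
  obtain ⟨q, hq⟩ := hQ.1
  obtain ⟨Ψ, hΨ, hL⟩ := hlin (ContinuousLinearEquiv.smulLeft (Units.mk0 α hα0))
  convert hQ.conj hS hp hj hΨ hL using 1
  funext z
  have h1 : Q (α • z) = α ^ j • Q z := by
    have := q.map_smul_univ (fun _ => α) (fun _ => z)
    simpa [hq] using this
  change c • Q z = α⁻¹ • Q (α • z)
  rw [h1, smul_smul, ← hα]
  congr 1
  obtain ⟨i, rfl⟩ : ∃ i, j = i + 1 := ⟨j - 1, by omega⟩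
  simp only [Nat.add_sub_cancel, pow_succ]
  field_simp

/-- If the values of a vector-valued polynomial lie in a submodule, so do its coefficients. -/
theorem coeff_mem_of_forall_sum_mem {M : Type*} [AddCommGroup M] [Module ℂ M]
    (V : Submodule ℂ M) (d : ℕ) (c : ℕ → M)
    (h : ∀ t : ℂ, ∑ i ∈ Finset.range d, t ^ i • c i ∈ V) {i : ℕ} (hi : i < d) : c i ∈ V := by
  by_contra hc
  obtain ⟨f, hf, hV⟩ := Submodule.exists_le_ker_of_notMem hc
  let P : Polynomial ℂ := ∑ i ∈ Finset.range d, Polynomial.monomial i (f (c i))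
  have hP : P = 0 := by
    refine Polynomial.funext fun t => ?_
    have := hV (h t)
    rw [LinearMap.mem_ker, map_sum] at this
    simpa [P, Polynomial.eval_finsetSum, mul_comm] using this
  have hcoef : P.coeff i = f (c i) := by
    simp [P, Polynomial.finsetSum_coeff, Polynomial.coeff_monomial, hi]
  exact hf (by rw [← hcoef, hP, Polynomial.coeff_zero])

/-- Polarization: a space of functions containing all `j`-th powers of linear forms contains all
products of `j` linear forms. -/
theorem prod_mem_of_forall_pow_mem (U : Submodule ℂ (E → ℂ)) (j : ℕ)
    (h : ∀ l : E →L[ℂ] ℂ, (fun z => l z ^ j) ∈ U) (ls : List (E →L[ℂ] ℂ)) (m : ℕ)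
    (hm : m + ls.length = j) (l : E →L[ℂ] ℂ) :
    (fun z => l z ^ m * (ls.map fun μ => μ z).prod) ∈ U := by
  induction ls generalizing m l with
  | nil =>
    obtain rfl : m = j := by simpa using hm
    simpa using h l
  | cons μ ls ih =>
    have h1 : ∀ t : ℂ, ∑ i ∈ Finset.range (m + 2), t ^ i •
        (fun z => (μ z ^ i * l z ^ (m + 1 - i) * (m + 1).choose i) *
          (ls.map fun μ => μ z).prod) ∈ U := by
      intro t
      convert ih (m + 1) (by simp at hm; omega) (t • μ + l) using 1
      funext z
      simp only [Finset.sum_apply, Pi.smul_apply, smul_eq_mul, add_apply,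
        smul_apply, add_pow, Finset.sum_mul, mul_pow]
      exact Finset.sum_congr rfl fun i _ => by ring
    have h2 := coeff_mem_of_forall_sum_mem U _ _ h1 (i := 1) (by omega)
    have h3 := U.smul_mem ((m + 1 : ℂ)⁻¹) h2
    convert h3 using 1
    funext z
    have : (m + 1 : ℂ) ≠ 0 := by exact_mod_cast Nat.succ_ne_zero m
    simp
    field_simp

/-- The linear transvection `z ↦ z + l z • v`. -/
noncomputable def transvectionEquiv (l : E →L[ℂ] ℂ) (v : E) (h : l v = 0) : E ≃L[ℂ] E :=
  ContinuousLinearEquiv.equivOfInverse (ContinuousLinearMap.id ℂ E + l.smulRight v)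
    (ContinuousLinearMap.id ℂ E - l.smulRight v)
    (fun z => by simp [h]) (fun z => by simp [h])

theorem transvectionEquiv_apply (l : E →L[ℂ] ℂ) (v : E) (h : l v = 0) (z : E) :
    transvectionEquiv l v h z = z + l z • v := rfl

theorem transvectionEquiv_symm_apply (l : E →L[ℂ] ℂ) (v : E) (h : l v = 0) (z : E) :
    (transvectionEquiv l v h).symm z = z - l z • v := rfl

end Group

section Generation

variable {n : ℕ}

/-- The submodule generated by shears and overshears exhausts all homogeneous polynomial maps. -/
theorem isLeadingTerm_of_generators (hn : 2 ≤ n)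
    {S : Subgroup (Equiv.Perm (EuclideanSpace ℂ (Fin n)))} {p : EuclideanSpace ℂ (Fin n)} {m : ℕ}
    (hm : 1 ≤ m) (hS : S ≤ holAut _) (hp : ∀ Φ ∈ S, Φ p = p)
    (hlin : ∀ L : EuclideanSpace ℂ (Fin n) ≃L[ℂ] EuclideanSpace ℂ (Fin n), ∃ Ψ ∈ S,
      HasFDerivAt Ψ (L : EuclideanSpace ℂ (Fin n) →L[ℂ] EuclideanSpace ℂ (Fin n)) p)
    (hshear : ∀ (a : Fin n) (l : EuclideanSpace ℂ (Fin n) →L[ℂ] ℂ),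
      l (EuclideanSpace.single a 1) = 0 →
      IsLeadingTerm S p (m + 1) (fun z => l z ^ (m + 1) • EuclideanSpace.single a 1))
    (hover : ∀ a b : Fin n, a ≠ b →
      IsLeadingTerm S p (m + 1) (fun z => (z b ^ m * z a) • EuclideanSpace.single a 1))
    (q : ContinuousMultilinearMap ℂ (fun _ : Fin (m + 1) => EuclideanSpace ℂ (Fin n))
      (EuclideanSpace ℂ (Fin n))) :
    IsLeadingTerm S p (m + 1) (fun z => q fun _ => z) := by
  have hj : 2 ≤ m + 1 := by omega
  have : Nontrivial (Fin n) := Fin.nontrivial_iff_two_le.2 hn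
  let V : Submodule ℂ (EuclideanSpace ℂ (Fin n) → EuclideanSpace ℂ (Fin n)) :=
    { carrier := {Q | IsLeadingTerm S p (m + 1) Q}
      add_mem' := fun hQ hR => hQ.add hS hp hj hR
      zero_mem' := IsLeadingTerm.zero
      smul_mem' := fun c _ hQ => hQ.smul hS hp hj hlin c }
  have hconj : ∀ {Q}, Q ∈ V → ∀ L : EuclideanSpace ℂ (Fin n) ≃L[ℂ] EuclideanSpace ℂ (Fin n),
      (fun z => L.symm (Q (L z))) ∈ V := fun {Q} hQ L => by
    obtain ⟨Ψ, hΨ, hL⟩ := hlin L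
    exact IsLeadingTerm.conj hS hp hj hQ hΨ hL
  have hcoord : ∀ a : Fin n, (fun z : EuclideanSpace ℂ (Fin n) =>
      z a ^ (m + 1) • EuclideanSpace.single a (1 : ℂ)) ∈ V := by
    intro a
    obtain ⟨b, hb⟩ := exists_ne a
    let u : ℕ → EuclideanSpace ℂ (Fin n) → EuclideanSpace ℂ (Fin n) := fun i z =>
      (z a ^ i * z b ^ (m - i) * m.choose i * z a) • EuclideanSpace.single a 1
    let w : ℕ → EuclideanSpace ℂ (Fin n) → EuclideanSpace ℂ (Fin n) := fun i z => match i with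
      | 0 => 0
      | i + 1 => -(z a ^ i * z b ^ (m - i) * m.choose i * z a) • EuclideanSpace.single b 1
    have h1 : ∀ t : ℂ, ∑ i ∈ Finset.range (m + 2), t ^ i • (u i + w i) ∈ V := by
      intro t
      have hl : (t • EuclideanSpace.proj a : EuclideanSpace ℂ (Fin n) →L[ℂ] ℂ)
          (EuclideanSpace.single b 1) = 0 := by simp [hb.symm]
      convert hconj (hover a b hb.symm) (transvectionEquiv _ _ hl) using 1
      funext z
      have hza : (transvectionEquiv _ _ hl z) a = z a := by
        simp [transvectionEquiv_apply, hb.symm]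
      have hzb : (transvectionEquiv _ _ hl z) b = t * z a + z b := by
        simp [transvectionEquiv_apply, add_comm]
      have hX : (t * z a + z b) ^ m * z a =
          ∑ i ∈ Finset.range (m + 1), t ^ i * (z a ^ i * z b ^ (m - i) * m.choose i * z a) := by
        rw [add_pow, Finset.sum_mul]
        exact Finset.sum_congr rfl fun i _ => by ring
      have hu : ∑ i ∈ Finset.range (m + 2), t ^ i • u i z =
          ((t * z a + z b) ^ m * z a) • EuclideanSpace.single a 1 := by
        rw [Finset.sum_range_succ, hX, Finset.sum_smul]
        simp [u, smul_smul]
      have hw : ∑ i ∈ Finset.range (m + 2), t ^ i • w i z =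
          -((t * ((t * z a + z b) ^ m * z a)) • EuclideanSpace.single b 1) := by
        rw [Finset.sum_range_succ', hX, Finset.mul_sum, Finset.sum_smul, ← Finset.sum_neg_distrib]
        simp only [w, smul_zero, add_zero]
        refine Finset.sum_congr rfl fun i _ => ?_
        rw [smul_smul, ← neg_smul]
        congr 1
        ring
      simp only [hza, hzb, transvectionEquiv_symm_apply, map_smul, Finset.sum_apply,
        Pi.smul_apply, Pi.add_apply, smul_add, Finset.sum_add_distrib, hu, hw]
      simp [sub_eq_add_neg, smul_smul, mul_comm]
    have h2 := coeff_mem_of_forall_sum_mem V _ _ h1 (i := m) (by omega)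
    have h3 := V.add_mem h2 (V.smul_mem (m : ℂ) (hover b a hb))
    convert h3 using 1
    obtain ⟨i, rfl⟩ : ∃ i, m = i + 1 := ⟨m - 1, by omega⟩
    funext z
    have hcancel : w (i + 1) z + ((i + 1 : ℕ) : ℂ) •
        ((z a ^ (i + 1) * z b) • EuclideanSpace.single b (1 : ℂ)) = 0 := by
      simp only [w]
      rw [smul_smul, ← add_smul, Nat.choose_succ_self_right, Nat.add_sub_cancel_left]
      convert zero_smul ℂ _ using 2
      ring
    simp only [Pi.add_apply, Pi.smul_apply, add_assoc]
    rw [hcancel]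
    simp [u, pow_succ]
  have hpow : ∀ (a : Fin n) (l : EuclideanSpace ℂ (Fin n) →L[ℂ] ℂ),
      (fun z => l z ^ (m + 1) • EuclideanSpace.single a (1 : ℂ)) ∈ V := by
    intro a l
    by_cases hl : l (EuclideanSpace.single a 1) = 0
    · exact hshear a l hl
    set c := l (EuclideanSpace.single a 1) with hc
    let μ : EuclideanSpace ℂ (Fin n) →L[ℂ] ℂ := c⁻¹ • l - EuclideanSpace.proj a
    have hμ : μ (EuclideanSpace.single a 1) = 0 := by
      simp [μ, ← hc, hl]
    have h1 := V.smul_mem (c ^ (m + 1)) (hconj (hcoord a) (transvectionEquiv μ _ hμ))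
    convert h1 using 1
    funext z
    have h2 : (transvectionEquiv μ _ hμ z) a = c⁻¹ * l z := by
      simp [transvectionEquiv_apply, μ]
    simp only [Pi.smul_apply, h2, map_smul, transvectionEquiv_symm_apply, hμ, zero_smul, sub_zero,
      smul_smul, ← mul_pow]
    rw [mul_inv_cancel_left₀ hl]
  have hprod : ∀ (a : Fin n) (ls : Fin (m + 1) → EuclideanSpace ℂ (Fin n) →L[ℂ] ℂ),
      (fun z => (∏ i, ls i z) • EuclideanSpace.single a (1 : ℂ)) ∈ V := by
    intro a ls
    let T : (EuclideanSpace ℂ (Fin n) → ℂ) →ₗ[ℂ]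
        (EuclideanSpace ℂ (Fin n) → EuclideanSpace ℂ (Fin n)) :=
      { toFun := fun f z => f z • EuclideanSpace.single a 1
        map_add' := fun f g => funext fun z => add_smul _ _ _
        map_smul' := fun c f => funext fun z => mul_smul _ _ _ }
    have h1 := prod_mem_of_forall_pow_mem (V.comap T) (m + 1) (fun l => hpow a l)
      (List.ofFn ls) 0 (by simp) 0
    have h2 : T (fun z => (0 : EuclideanSpace ℂ (Fin n) →L[ℂ] ℂ) z ^ 0 *
      ((List.ofFn ls).map fun μ => μ z).prod) ∈ V := h1
    convert h2 using 1
    funext z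
    simp only [T, List.map_ofFn, List.prod_ofFn, pow_zero, one_mul, LinearMap.coe_mk,
      AddHom.coe_mk, Function.comp_apply]
  suffices h : (fun z => q fun _ => z) ∈ V from h
  have hdecomp : (fun z : EuclideanSpace ℂ (Fin n) => q fun _ => z) =
      ∑ r : Fin (m + 1) → Fin n, ∑ a : Fin n, (q fun i => EuclideanSpace.single (r i) 1) a •
        fun z : EuclideanSpace ℂ (Fin n) =>
          (∏ i, (EuclideanSpace.proj (r i) : EuclideanSpace ℂ (Fin n) →L[ℂ] ℂ) z) •
            EuclideanSpace.single a (1 : ℂ) := by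
    funext z
    have hz : ∀ x : EuclideanSpace ℂ (Fin n), x = ∑ a, x a • EuclideanSpace.single a (1 : ℂ) := by
      intro x
      ext i
      simp [Finset.sum_apply, Pi.single_apply]
    conv_lhs => rw [hz z]
    rw [q.map_sum (fun _ a => z a • EuclideanSpace.single a (1 : ℂ))]
    simp only [Finset.sum_apply]
    refine Finset.sum_congr rfl fun r _ => ?_
    rw [q.map_smul_univ (fun i => z (r i)) (fun i => EuclideanSpace.single (r i) (1 : ℂ)),
      hz (q fun i => EuclideanSpace.single (r i) 1), Finset.smul_sum]
    refine Finset.sum_congr rfl fun a _ => ?_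
    rw [← hz (q fun i => EuclideanSpace.single (r i) 1)]
    simp only [Pi.smul_apply, smul_smul]
    rw [mul_comm]
    rfl
  rw [hdecomp]
  exact sum_mem fun r _ => sum_mem fun a _ => V.smul_mem _ (hprod a _)

/-- If the derivatives at `p` of the elements of `S` include transvections and dilations in the
coordinate directions, they include all invertible linear maps. -/
theorem exists_hasFDerivAt_of_generators
    {S : Subgroup (Equiv.Perm (EuclideanSpace ℂ (Fin n)))} {p : EuclideanSpace ℂ (Fin n)}
    (hp : ∀ Φ ∈ S, Φ p = p)
    (htrans : ∀ (a b : Fin n) (c : ℂ), a ≠ b → ∃ Ψ ∈ S, HasFDerivAt Ψ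
      (ContinuousLinearMap.id ℂ (EuclideanSpace ℂ (Fin n)) +
        (c • EuclideanSpace.proj b : EuclideanSpace ℂ (Fin n) →L[ℂ] ℂ).smulRight
          (EuclideanSpace.single a 1)) p)
    (hdil : ∀ (a : Fin n) (c : ℂ), c ≠ 0 → ∃ Ψ ∈ S, HasFDerivAt Ψ
      (ContinuousLinearMap.id ℂ (EuclideanSpace ℂ (Fin n)) +
        ((c - 1) • EuclideanSpace.proj a : EuclideanSpace ℂ (Fin n) →L[ℂ] ℂ).smulRight
          (EuclideanSpace.single a 1)) p)
    (L : EuclideanSpace ℂ (Fin n) ≃L[ℂ] EuclideanSpace ℂ (Fin n)) :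
    ∃ Ψ ∈ S, HasFDerivAt Ψ
      (L : EuclideanSpace ℂ (Fin n) →L[ℂ] EuclideanSpace ℂ (Fin n)) p := by
  let T := Matrix.toEuclideanCLM (n := Fin n) (𝕜 := ℂ)
  let P : Matrix (Fin n) (Fin n) ℂ → Prop := fun M => ∃ Ψ ∈ S, HasFDerivAt Ψ (T M) p
  have hmul : ∀ A B, P A → P B → P (A * B) := by
    rintro A B ⟨Φ, hΦ, hA⟩ ⟨Ψ, hΨ, hB⟩
    refine ⟨Φ * Ψ, mul_mem hΦ hΨ, ?_⟩
    rw [map_mul]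
    exact HasFDerivAt.comp (f := Ψ) (g := Φ) p (by rwa [hp Ψ hΨ]) hB
  have hone : P 1 := ⟨1, one_mem _, by rw [map_one]; exact hasFDerivAt_id p⟩
  have hdiag : ∀ (a : Fin n) (c : ℂ), c ≠ 0 →
      P (Matrix.diagonal (Function.update 1 a c)) := by
    intro a c hc
    convert hdil a c hc using 4
    ext z i
    rcases eq_or_ne i a with rfl | hi
    · simp [T, Matrix.ofLp_toEuclideanCLM, Matrix.mulVec_diagonal]
      ring
    · simp [T, Matrix.ofLp_toEuclideanCLM, Matrix.mulVec_diagonal, hi]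
  suffices h : P (T.symm L) by simpa [P] using h
  refine Matrix.diagonal_transvection_induction_of_det_ne_zero P _ ?_ ?_ ?_
    fun A B _ _ => hmul A B
  · rw [← isUnit_iff_ne_zero, ← Matrix.isUnit_iff_isUnit_det]
    refine IsUnit.map T.symm ?_
    exact ⟨⟨L, L.symm, by ext; simp, by ext; simp⟩, rfl⟩
  · intro D hD
    have hD0 : ∀ a, D a ≠ 0 := by
      rw [Matrix.det_diagonal, Finset.prod_ne_zero_iff] at hD
      exact fun a => hD a (Finset.mem_univ a)
    suffices h : ∀ s : Finset (Fin n), P (Matrix.diagonal fun a => if a ∈ s then D a else 1) by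
      simpa using h Finset.univ
    intro s
    induction s using Finset.induction_on with
    | empty => simpa using hone
    | insert a s ha ih =>
      convert hmul _ _ ih (hdiag a (D a) (hD0 a)) using 1
      rw [Matrix.diagonal_mul_diagonal]
      congr 1
      funext i
      rcases eq_or_ne i a with rfl | hi <;> simp_all
  · rintro ⟨a, b, hab, c⟩
    convert htrans a b c hab using 4
    ext z i
    rcases eq_or_ne i a with rfl | hi <;>
      simp_all [T, Matrix.TransvectionStruct.toMatrix, Matrix.transvection,
        Matrix.ofLp_toEuclideanCLM, Matrix.single_mulVec]

end Generation

section Shears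

variable {E : Type*} [NormedAddCommGroup E] [NormedSpace ℂ E]

theorem exists_holAut_shear {v : E → E} (hv : ContDiff ℂ ω v) (hadd : ∀ z, v (z + v z) = v z)
    (hsub : ∀ z, v (z - v z) = v z) : ∃ Φ ∈ holAut E, ∀ z, Φ z = z + v z :=
  ⟨⟨fun z => z + v z, fun z => z - v z, fun z => by simp [hadd], fun z => by simp [hsub]⟩,
    ⟨contDiff_id.add hv, contDiff_id.sub hv⟩, fun _ => rfl⟩

theorem exists_holAut_overshear {w : E → ℂ} (hw : ContDiff ℂ ω w) {e : E}
    (hwe : ∀ z (s : ℂ), w (z + s • e) = w z) {l : E →L[ℂ] ℂ} (hle : l e = 1) (c : ℂ) :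
    ∃ Φ ∈ holAut E, ∀ z, Φ z = z + ((Complex.exp (w z) - 1) * (l z - c)) • e := by
  have hinv : ∀ w : E → ℂ, (∀ z (s : ℂ), w (z + s • e) = w z) → Function.LeftInverse
      (fun z => z + ((Complex.exp (-w z) - 1) * (l z - c)) • e)
      (fun z => z + ((Complex.exp (w z) - 1) * (l z - c)) • e) := by
    intro w hwe z
    simp only [hwe, map_add, map_smul, hle, smul_eq_mul, mul_one, add_assoc, ← add_smul]
    rw [add_eq_left, Complex.exp_neg]
    have := Complex.exp_ne_zero (w z)
    convert zero_smul ℂ e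
    field_simp
    ring
  refine ⟨⟨fun z => z + ((Complex.exp (w z) - 1) * (l z - c)) • e,
    fun z => z + ((Complex.exp (-w z) - 1) * (l z - c)) • e, hinv w hwe, ?_⟩, ⟨?_, ?_⟩,
    fun _ => rfl⟩
  · simpa using! hinv (fun z => -w z) fun z s => by rw [hwe]
  · change ContDiff ℂ ω fun z => z + ((Complex.exp (w z) - 1) * (l z - c)) • e
    fun_prop
  · change ContDiff ℂ ω fun z => z + ((Complex.exp (-w z) - 1) * (l z - c)) • e
    fun_prop

theorem isLittleO_eval_of_dvd {l : E →L[ℂ] ℂ} {p : E} {k : ℕ} {χ : Polynomial ℂ}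
    (h : (Polynomial.X - Polynomial.C (l p)) ^ (k + 1) ∣ χ) :
    (fun z => χ.eval (l z)) =o[𝓝 p] fun z => ‖z - p‖ ^ k := by
  obtain ⟨r, rfl⟩ := h
  have h1 : (fun z => l z - l p) =O[𝓝 p] fun z => z - p :=
    l.differentiableAt.isBigO_sub
  have h2 : (fun z => r.eval (l z)) =O[𝓝 p] fun _ => (1 : ℝ) :=
    ((r.continuous.comp l.continuous).tendsto p).isBigO_one ℝ
  have h3 : (fun z => ‖z - p‖ ^ (k + 1) * 1) =o[𝓝 p] fun z => ‖z - p‖ ^ k := by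
    have ht : Tendsto (fun z => ‖z - p‖) (𝓝 p) (𝓝 0) := by
      simpa using (continuous_id.sub continuous_const).norm.tendsto (f := fun z : E => ‖z - p‖) p
    simpa using! (isLittleO_pow_pow (𝕜 := ℝ) (Nat.lt_succ_self k)).comp_tendsto ht
  simpa using! ((h1.norm_right.pow (k + 1)).mul h2).trans_isLittleO h3

/-- A holomorphic function of `l z` that is `1` to order `k` at `p` and `0` to order `k` on `P`. -/
theorem exists_cutoff {P : Set E} (hP : P.Finite) {p : E} {l : E →L[ℂ] ℂ}
    (hl : ∀ q ∈ P, l q ≠ l p) (k : ℕ) :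
    ∃ χ : E → ℂ, ContDiff ℂ ω χ ∧ (∀ z v, l v = 0 → χ (z + v) = χ z) ∧
      JetEq k χ (fun _ => 1) p ∧ ∀ q ∈ P, JetEq k χ (fun _ => 0) q := by
  have hco : IsCoprime ((Polynomial.X - Polynomial.C (l p)) ^ (k + 1))
      (∏ q ∈ hP.toFinset, (Polynomial.X - Polynomial.C (l q)) ^ (k + 1)) := by
    refine IsCoprime.prod_right fun q hq => IsCoprime.pow ?_
    exact Polynomial.isCoprime_X_sub_C_of_isUnit_sub
      (sub_ne_zero.2 (hl q (hP.mem_toFinset.1 hq)).symm).isUnit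
  obtain ⟨r, s, hrs⟩ := hco
  set R := ∏ q ∈ hP.toFinset, (Polynomial.X - Polynomial.C (l q)) ^ (k + 1) with hR
  refine ⟨fun z => (s * R).eval (l z), ?_, fun z v hv => by simp [hv], ?_, fun q hq => ?_⟩
  · have h := (Polynomial.contDiff_aeval (s * R) ω (𝕜 := ℂ)).comp l.contDiff
    simpa [Function.comp_def] using h
  · have h := isLittleO_eval_of_dvd (l := l) (p := p) (k := k)
      ((dvd_mul_left _ (-r)))
    refine h.congr_left fun z => ?_
    rw [← eq_sub_iff_add_eq'] at hrs
    rw [hrs]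
    simp
  · have h := isLittleO_eval_of_dvd (l := l) (p := q) (k := k) (χ := s * R)
      (Dvd.dvd.mul_left (Finset.dvd_prod_of_mem _ (hP.mem_toFinset.2 hq)) s)
    simpa [JetEq] using! h

theorem JetEq.mul_right {k : ℕ} {f g r : E → ℂ} {p : E} (H : JetEq k f g p)
    (hr : ContinuousAt r p) : JetEq k (fun z => f z * r z) (fun z => g z * r z) p := by
  have h : r =O[𝓝 p] fun _ => (1 : ℝ) := hr.tendsto.isBigO_one ℝ
  simpa [JetEq, sub_mul] using! IsLittleO.mul_isBigO H h

theorem JetEq.add_smul {k : ℕ} {f g : E → ℂ} {p : E} (H : JetEq k f g p) (e : E) :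
    JetEq k (fun z => z + f z • e) (fun z => z + g z • e) p := by
  have h : (fun _ : E => e) =O[𝓝 p] fun _ => (1 : ℝ) := (isBigO_const_const _ one_ne_zero _)
  have := IsLittleO.smul_isBigO H h
  simpa [JetEq, sub_smul] using! this

variable {P : Set E} {p e : E} {l l' : E →L[ℂ] ℂ}

theorem exists_localAut_shear (k : ℕ) (hP : P.Finite) (hl : ∀ q ∈ P, l q ≠ l p) (hle : l e = 0)
    {u : E → ℂ} (hu : ContDiff ℂ ω u) (hue : ∀ z (s : ℂ), u (z + s • e) = u z) (hup : u p = 0) :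
    ∃ Φ ∈ localAut k P p, JetEq k Φ (fun z => z + u z • e) p := by
  obtain ⟨χ, hχ, hχe, hχp, hχP⟩ := exists_cutoff hP hl k
  have hχe' : ∀ z (s : ℂ), χ (z + s • e) = χ z := fun z s => hχe z _ (by simp [hle])
  obtain ⟨Φ, hΦ, hΦz⟩ := exists_holAut_shear (v := fun z => (χ z * u z) • e) (by fun_prop)
    (fun z => by simp [hχe', hue]) (fun z => by simp [sub_eq_add_neg, ← neg_smul, hχe', hue])
  have hfun : (Φ : E → E) = fun z => z + (χ z * u z) • e := funext hΦz
  refine ⟨Φ, ⟨hΦ, by simp [hΦz, hup], fun q hq => ?_⟩, ?_⟩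
  · rw [hfun]
    simpa using! ((hχP q hq).mul_right hu.continuous.continuousAt).add_smul e
  · rw [hfun]
    simpa using! (hχp.mul_right hu.continuous.continuousAt).add_smul e

theorem exists_localAut_overshear (k : ℕ) (hP : P.Finite) (hl : ∀ q ∈ P, l q ≠ l p) (hle : l e = 0)
    (hl'e : l' e = 1) {u : E → ℂ} (hu : ContDiff ℂ ω u) (hue : ∀ z (s : ℂ), u (z + s • e) = u z) :
    ∃ Φ ∈ localAut k P p,
      JetEq k Φ (fun z => z + ((Complex.exp (u z) - 1) * l' (z - p)) • e) p := by
  obtain ⟨χ, hχ, hχe, hχp, hχP⟩ := exists_cutoff hP hl k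
  have hχe' : ∀ z (s : ℂ), χ (z + s • e) = χ z := fun z s => hχe z _ (by simp [hle])
  obtain ⟨Φ, hΦ, hΦz⟩ := exists_holAut_overshear (w := fun z => χ z * u z) (by fun_prop)
    (fun z s => by simp [hχe', hue]) hl'e (l' p)
  have hfun : (Φ : E → E) = fun z => z + ((Complex.exp (χ z * u z) - 1) * (l' z - l' p)) • e :=
    funext hΦz
  have hχc := hχ.continuous
  have huc := hu.continuous
  have hexp : ContDiff ℂ ω fun x => Complex.exp x - 1 := by fun_prop
  have hl'c : ∀ q, ContinuousAt (fun z => l' z - l' p) q := fun q => by fun_prop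
  have key : ∀ (c : ℂ) q, JetEq k χ (fun _ => c) q → JetEq k Φ
      (fun z => z + ((Complex.exp (c * u z) - 1) * (l' z - l' p)) • e) q := by
    intro c q h
    rw [hfun]
    exact (((h.mul_right hu.continuous.continuousAt).comp_left hexp
      (by fun_prop) (by fun_prop)).mul_right (hl'c q)).add_smul e
  refine ⟨Φ, ⟨hΦ, by simp [hΦz], fun q hq => ?_⟩, ?_⟩
  · simpa using! key 0 q (hχP q hq)
  · simpa using! key 1 p hχp

end Shears

section FirstOrder

variable {E F : Type*} [NormedAddCommGroup E] [NormedSpace ℂ E]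
  [NormedAddCommGroup F] [NormedSpace ℂ F]

theorem JetEq.hasFDerivAt {f g : E → F} {p : E} {L : E →L[ℂ] F} (H : JetEq 1 f g p)
    (hg : HasFDerivAt g L p) : HasFDerivAt f L p := by
  have h : (fun z => f z - g z) =o[𝓝 p] fun z => z - p := by
    simpa [JetEq] using! H
  refine HasFDerivAt.of_isLittleO ((h.add hg.isLittleO).congr_left fun z => ?_)
  rw [H.apply_eq]
  abel

theorem jetEq_one_of_hasFDerivAt {f g : E → F} {p : E} {L : E →L[ℂ] F} (hf : HasFDerivAt f L p)
    (hg : HasFDerivAt g L p) (hfg : f p = g p) : JetEq 1 f g p := by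
  have h := (hf.isLittleO.sub hg.isLittleO).norm_right
  simp only [JetEq, pow_one]
  refine h.congr_left fun z => ?_
  rw [hfg]
  abel

end FirstOrder

section SinglePoint

variable {n : ℕ} {k : ℕ} {P : Set (EuclideanSpace ℂ (Fin n))} {p : EuclideanSpace ℂ (Fin n)}

theorem exists_localAut_hasFDerivAt (hn : 2 ≤ n) (hk : 1 ≤ k) (hP : P.Finite)
    (hsep : ∀ q ∈ P, ∀ b, q b ≠ p b)
    (L : EuclideanSpace ℂ (Fin n) ≃L[ℂ] EuclideanSpace ℂ (Fin n)) :
    ∃ Ψ ∈ localAut k P p, HasFDerivAt Ψ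
      (L : EuclideanSpace ℂ (Fin n) →L[ℂ] EuclideanSpace ℂ (Fin n)) p := by
  have : Nontrivial (Fin n) := Fin.nontrivial_iff_two_le.2 hn
  have hlinear : ∀ (l : EuclideanSpace ℂ (Fin n) →L[ℂ] ℂ) (e : EuclideanSpace ℂ (Fin n)),
      HasFDerivAt (fun z => z + l (z - p) • e)
        (ContinuousLinearMap.id ℂ (EuclideanSpace ℂ (Fin n)) + l.smulRight e) p := by
    intro l e
    have h := (l.smulRight e).hasFDerivAt.comp p ((hasFDerivAt_id p).sub_const p)
    exact (hasFDerivAt_id p).add h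
  refine exists_hasFDerivAt_of_generators (S := localAut k P p) (fun Φ hΦ => hΦ.2.1)
    (fun a b c hab => ?_) (fun a c hc => ?_) L
  · obtain ⟨Φ, hΦ, H⟩ := exists_localAut_shear (e := EuclideanSpace.single a 1)
      (l := EuclideanSpace.proj b) k hP (fun q hq => hsep q hq b) (by simp [hab.symm])
      (u := fun z => (c • EuclideanSpace.proj b : EuclideanSpace ℂ (Fin n) →L[ℂ] ℂ) (z - p))
      (by fun_prop) (fun z s => by simp [hab.symm]) (by simp)
    exact ⟨Φ, hΦ, (H.mono hk).hasFDerivAt (hlinear _ _)⟩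
  · obtain ⟨b, hb⟩ := exists_ne a
    obtain ⟨Φ, hΦ, H⟩ := exists_localAut_overshear (e := EuclideanSpace.single a 1)
      (l := EuclideanSpace.proj b) (l' := EuclideanSpace.proj a) k hP (fun q hq => hsep q hq b)
      (by simp [hb]) (by simp) (u := fun _ => Complex.log c) contDiff_const (fun _ _ => rfl)
    rw [Complex.exp_log hc] at H
    have h1 := hlinear ((c - 1) • EuclideanSpace.proj a) (EuclideanSpace.single a 1)
    simp only [smul_apply, smul_eq_mul] at h1
    have h2 := (H.mono hk).hasFDerivAt h1
    exact ⟨Φ, hΦ, h2⟩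

theorem exists_multilinear_eq_prod {m : ℕ} (l : Fin m → EuclideanSpace ℂ (Fin n) →L[ℂ] ℂ)
    (e : EuclideanSpace ℂ (Fin n)) :
    ∃ q : ContinuousMultilinearMap ℂ (fun _ : Fin m => EuclideanSpace ℂ (Fin n))
      (EuclideanSpace ℂ (Fin n)), ∀ z, (∏ i, l i z) • e = q fun _ => z :=
  ⟨((ContinuousMultilinearMap.mkPiAlgebra ℂ (Fin m) ℂ).compContinuousLinearMap l).smulRight e,
    fun z => by simp⟩

theorem isLeadingTerm_shear (hn : 2 ≤ n) (hP : P.Finite) (hsep : ∀ q ∈ P, ∀ b, q b ≠ p b)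
    {m : ℕ} (hmk : m + 1 ≤ k) (a : Fin n) (l : EuclideanSpace ℂ (Fin n) →L[ℂ] ℂ)
    (hl : l (EuclideanSpace.single a 1) = 0) :
    IsLeadingTerm (localAut k P p) p (m + 1)
      (fun z => l z ^ (m + 1) • EuclideanSpace.single a 1) := by
  have : Nontrivial (Fin n) := Fin.nontrivial_iff_two_le.2 hn
  obtain ⟨b, hb⟩ := exists_ne a
  refine ⟨?_, ?_⟩
  · simpa using exists_multilinear_eq_prod (fun _ : Fin (m + 1) => l) (EuclideanSpace.single a 1)
  obtain ⟨Φ, hΦ, H⟩ := exists_localAut_shear (e := EuclideanSpace.single a 1)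
    (l := EuclideanSpace.proj b) k hP (fun q hq => hsep q hq b) (by simp [hb])
    (u := fun z => l (z - p) ^ (m + 1)) (by fun_prop) (fun z s => by simp [hl]) (by simp)
  exact ⟨Φ, hΦ, H.mono hmk⟩

theorem isLeadingTerm_overshear (hP : P.Finite) (hsep : ∀ q ∈ P, ∀ b, q b ≠ p b)
    {m : ℕ} (hm : 1 ≤ m) (hmk : m + 1 ≤ k) {a b : Fin n} (hab : a ≠ b) :
    IsLeadingTerm (localAut k P p) p (m + 1)
      (fun z => (z b ^ m * z a) • EuclideanSpace.single a 1) := by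
  refine ⟨?_, ?_⟩
  · simpa [Fin.prod_univ_castSucc] using exists_multilinear_eq_prod
      (Fin.snoc (α := fun _ => EuclideanSpace ℂ (Fin n) →L[ℂ] ℂ)
        (fun _ : Fin m => EuclideanSpace.proj b) (EuclideanSpace.proj a))
      (EuclideanSpace.single a 1)
  obtain ⟨Φ, hΦ, H⟩ := exists_localAut_overshear (e := EuclideanSpace.single a 1)
    (l := EuclideanSpace.proj b) (l' := EuclideanSpace.proj a) k hP (fun q hq => hsep q hq b)
    (by simp [hab.symm]) (by simp) (u := fun z => (z b - p b) ^ m) (by fun_prop)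
    (fun z s => by simp [hab.symm])
  refine ⟨Φ, hΦ, (H.mono hmk).trans ?_⟩
  have hproj : ∀ c : Fin n, (fun z : EuclideanSpace ℂ (Fin n) => z c - p c) =O[𝓝 p]
      fun z => ‖z - p‖ := fun c => by
    simpa using! ((EuclideanSpace.proj c : EuclideanSpace ℂ (Fin n) →L[ℂ] ℂ).isBigO_comp
      (fun z => z - p) (𝓝 p)).norm_right
  have hu : Tendsto (fun z : EuclideanSpace ℂ (Fin n) => (z b - p b) ^ m) (𝓝 p) (𝓝 0) := by
    have : Continuous fun z : EuclideanSpace ℂ (Fin n) => (z b - p b) ^ m := by fun_prop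
    simpa [show m ≠ 0 by omega] using this.tendsto p
  have hexp : (fun x => Complex.exp x - 1 - x) =o[𝓝 0] fun x => x := by
    simpa using! (Complex.hasDerivAt_exp 0).isLittleO
  have h1 := ((hexp.comp_tendsto hu).trans_isBigO ((hproj b).pow m)).mul_isBigO (hproj a)
  have h2 : JetEq (m + 1) (fun z : EuclideanSpace ℂ (Fin n) =>
      (Complex.exp ((z b - p b) ^ m) - 1) * (z a - p a))
      (fun z => (z b - p b) ^ m * (z a - p a)) p :=
    h1.congr (fun z => by simp; ring) (fun z => by ring)
  simpa using! h2.add_smul (EuclideanSpace.single a 1)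

/-- Jets at a single point are realised by automorphisms tangent to the identity on `P`. -/
theorem exists_localAut_jetEq (hn : 2 ≤ n) (hk : 1 ≤ k) (hP : P.Finite)
    (hsep : ∀ q ∈ P, ∀ b, q b ≠ p b) {g : EuclideanSpace ℂ (Fin n) → EuclideanSpace ℂ (Fin n)}
    (hg : ContDiff ℂ ω g) (hgp : g p = p)
    {L : EuclideanSpace ℂ (Fin n) ≃L[ℂ] EuclideanSpace ℂ (Fin n)}
    (hL : HasFDerivAt g (L : EuclideanSpace ℂ (Fin n) →L[ℂ] EuclideanSpace ℂ (Fin n)) p) :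
    ∃ Φ ∈ localAut k P p, JetEq k Φ g p := by
  have hlin := exists_localAut_hasFDerivAt hn hk hP hsep
  suffices ∀ j, 1 ≤ j → j ≤ k → ∃ Φ ∈ localAut k P p, JetEq j Φ g p from this k hk le_rfl
  intro j hj
  induction j, hj using Nat.le_induction with
  | base =>
    intro _
    obtain ⟨Φ, hΦ, h⟩ := hlin L
    exact ⟨Φ, hΦ, jetEq_one_of_hasFDerivAt h hL (by rw [hΦ.2.1, hgp])⟩
  | succ j hj ih =>
    intro hjk
    obtain ⟨Φ, hΦ, H⟩ := ih (by omega)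
    have hΦp : Φ.symm p = p := by rw [Equiv.symm_apply_eq, hΦ.2.1]
    have h1 : JetEq j (fun z => Φ (Φ.symm z)) (fun z => g (Φ.symm z)) p :=
      JetEq.comp_right (f := Φ) (g := g) (Φ := Φ.symm) (by rwa [hΦp])
        (hΦ.1.2.differentiable (by simp) p)
    have h2 : (fun z => g (Φ.symm z) - z) =o[𝓝 p] fun z => ‖z - p‖ ^ j := by
      simpa [JetEq] using! h1.symm
    obtain ⟨q, hq⟩ := exists_leading_term ((hg.comp hΦ.1.2).sub contDiff_id) h2
    obtain ⟨-, Ψ, hΨ, HΨ⟩ := isLeadingTerm_of_generators (S := localAut k P p) hn hj (fun _ h => h.1)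
      (fun _ h => h.2.1) hlin (fun a l hl => isLeadingTerm_shear hn hP hsep hjk a l hl)
      (fun a b hab => isLeadingTerm_overshear hP hsep hj hjk hab) q
    refine ⟨Ψ * Φ, mul_mem hΨ hΦ, ?_⟩
    have h3 : JetEq (j + 1) Ψ (fun z => g (Φ.symm z)) p :=
      (IsLittleO.sub HΨ hq).congr_left fun z => by
        simp only [Function.comp_apply, id]
        abel
    have h4 := JetEq.comp_right (f := Ψ) (g := fun z => g (Φ.symm z)) (Φ := Φ) (q := p)
      (by rwa [hΦ.2.1]) (differentiable_of_mem_holAut hΦ.1 p)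
    simpa using! h4

end SinglePoint

section Combine

variable {E ι : Type*} [NormedAddCommGroup E] [NormedSpace ℂ E]

/-- Automorphisms with prescribed jets at single points, tangent to the identity at the other
points, compose to an automorphism with all the prescribed jets. -/
theorem exists_holAut_jetEq [Fintype ι] {k : ℕ} {p : ι → E} {h : ι → E → E}
    (H : ∀ i, ∃ Φ ∈ localAut k {q | ∃ j, j ≠ i ∧ q = p j} (p i), JetEq k Φ (h i) (p i)) :
    ∃ Φ ∈ holAut E, ∀ i, JetEq k Φ (h i) (p i) := by
  classical
  choose Ψ hΨ HΨ using H
  suffices ∀ s : Finset ι, ∃ Φ ∈ holAut E, (∀ i ∈ s, JetEq k Φ (h i) (p i)) ∧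
      ∀ i ∉ s, JetEq k Φ id (p i) by
    obtain ⟨Φ, hΦ, h1, -⟩ := this Finset.univ
    exact ⟨Φ, hΦ, fun i => h1 i (Finset.mem_univ i)⟩
  intro s
  induction s using Finset.induction_on with
  | empty => exact ⟨1, one_mem _, by simp, fun i _ => JetEq.refl k _ _⟩
  | insert a s has ih =>
    obtain ⟨Φ, hΦ, h1, h2⟩ := ih
    have hd := differentiable_of_mem_holAut (hΨ a).1
    have hfix : ∀ i, Ψ a (p i) = p i := fun i => by
      rcases eq_or_ne i a with rfl | hi
      · exact (hΨ i).2.1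
      · exact ((hΨ a).2.2 _ ⟨i, hi, rfl⟩).apply_eq
    have hother : ∀ i, i ≠ a → JetEq k (fun z => Φ (Ψ a z)) Φ (p i) := fun i hi =>
      ((hΨ a).2.2 _ ⟨i, hi, rfl⟩).comp_left hΦ.1 hd.continuous.continuousAt continuousAt_id
    refine ⟨Φ * Ψ a, mul_mem hΦ (hΨ a).1, fun i hi => ?_, fun i hi => ?_⟩
    · rcases eq_or_ne i a with rfl | hia
      · exact (JetEq.comp_right (f := Φ) (g := id) (by rw [hfix]; exact h2 i has) (hd _)).trans
          (HΨ i)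
      · exact (hother i hia).trans (h1 i (Finset.mem_of_mem_insert_of_ne hi hia))
    · rw [Finset.mem_insert, not_or] at hi
      exact (hother i hi.1).trans (h2 i hi.2)

end Combine

section Points

variable {n : ℕ} {ι : Type*} [Fintype ι]

theorem exists_contDiff_interpolation {t : ι → ℂ} (ht : Function.Injective t) (r : ι → ℂ) :
    ∃ f : ℂ → ℂ, ContDiff ℂ ω f ∧ ∀ i, f (t i) = r i := by
  classical
  refine ⟨fun z => (Lagrange.interpolate Finset.univ t r).eval z, ?_, fun i => ?_⟩
  · simpa only [Polynomial.coe_aeval_eq_eval] using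
      (Lagrange.interpolate Finset.univ t r).contDiff_aeval ω (𝕜 := ℂ)
  · exact Lagrange.eval_interpolate_at_node r ht.injOn (Finset.mem_univ i)

theorem exists_holAut_separate {x : ι → EuclideanSpace ℂ (Fin n)} (hx : Function.Injective x)
    (o : Fin n) (ho : (o : ℕ) = 0) :
    ∃ Φ ∈ holAut (EuclideanSpace ℂ (Fin n)), Function.Injective fun i => Φ (x i) o := by
  classical
  let Q : ι × ι → Polynomial ℂ := fun i =>
    ∑ a : Fin n, Polynomial.monomial (a : ℕ) (x i.1 a - x i.2 a)
  have hQ : ∀ i, i.1 ≠ i.2 → Q i ≠ 0 := by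
    intro i hi h0
    refine hi (hx (PiLp.ext fun a => ?_))
    have := congrArg (fun q => q.coeff (a : ℕ)) h0
    simpa [Q, Polynomial.finsetSum_coeff, Polynomial.coeff_monomial, Fin.val_inj, sub_eq_zero]
      using this
  obtain ⟨t, ht⟩ := Infinite.exists_notMem_finset
    (Finset.univ.biUnion fun i => (Q i).roots.toFinset)
  have htQ : ∀ i, i.1 ≠ i.2 → (Q i).eval t ≠ 0 := by
    intro i hi h0
    refine ht (Finset.mem_biUnion.2 ⟨i, Finset.mem_univ i, ?_⟩)
    simpa [hQ i hi] using h0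
  let l : EuclideanSpace ℂ (Fin n) →L[ℂ] ℂ :=
    ∑ a ∈ Finset.univ.erase o, t ^ (a : ℕ) • EuclideanSpace.proj a
  have hl : ∀ z, l z = ∑ a ∈ Finset.univ.erase o, t ^ (a : ℕ) * z a := fun z => by
    simp [l]
  have hlo : l (EuclideanSpace.single o 1) = 0 := by
    rw [hl]
    refine Finset.sum_eq_zero fun a ha => ?_
    simp [Finset.ne_of_mem_erase ha]
  obtain ⟨Φ, hΦ, hΦz⟩ := exists_holAut_shear (v := fun z => l z • EuclideanSpace.single o (1 : ℂ))
    (by fun_prop) (fun z => by simp [hlo]) (fun z => by simp [hlo])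
  have hsum : ∀ i, Φ (x i) o = ∑ a : Fin n, t ^ (a : ℕ) * x i a := fun i => by
    rw [← Finset.add_sum_erase _ _ (Finset.mem_univ o), hΦz, ho]
    simp [hl]
  refine ⟨Φ, hΦ, fun i j hij => ?_⟩
  by_contra hne
  refine htQ (i, j) hne ?_
  simp only [hsum] at hij
  rw [← sub_eq_zero, ← Finset.sum_sub_distrib] at hij
  rw [← hij]
  simp only [Q, Polynomial.eval_finsetSum, Polynomial.eval_monomial]
  exact Finset.sum_congr rfl fun a _ => by ring

/-- Distinct points can be moved to the points with all coordinates equal to prescribed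
distinct numbers. -/
theorem exists_holAut_apply_eq (hn : 2 ≤ n) {x : ι → EuclideanSpace ℂ (Fin n)}
    (hx : Function.Injective x) {s : ι → ℂ} (hs : Function.Injective s) :
    ∃ Φ ∈ holAut (EuclideanSpace ℂ (Fin n)), ∀ i, Φ (x i) = WithLp.toLp 2 fun _ => s i := by
  classical
  let o : Fin n := ⟨0, by omega⟩
  let o' : Fin n := ⟨1, by omega⟩
  have hoo' : o' ≠ o := by simp [o, o']
  obtain ⟨Φ₁, hΦ₁, hinj⟩ := exists_holAut_separate hx o rfl
  choose f hf hfi using fun a : Fin n =>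
    exists_contDiff_interpolation hinj fun i => if a = o then 0 else s i - Φ₁ (x i) a
  let v : EuclideanSpace ℂ (Fin n) → EuclideanSpace ℂ (Fin n) := fun z =>
    WithLp.toLp 2 fun a => if a = o then 0 else f a (z o)
  have hvo : ∀ z, v z o = 0 := fun z => by simp [v]
  have hv : ContDiff ℂ ω v := by
    refine contDiff_euclidean.2 fun a => ?_
    have := hf a
    by_cases ha : a = o
    · simpa [v, ha] using contDiff_const
    · simp only [v, ha, if_false]
      fun_prop
  obtain ⟨Φ₂, hΦ₂, hΦ₂z⟩ := exists_holAut_shear hv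
    (fun z => by ext a; simp [v]) (fun z => by ext a; simp [v])
  have h2 : ∀ i a, a ≠ o → Φ₂ (Φ₁ (x i)) a = s i := fun i a ha => by
    simp [hΦ₂z, v, ha, hfi]
  obtain ⟨g, hg, hgi⟩ := exists_contDiff_interpolation hs fun i => s i - Φ₂ (Φ₁ (x i)) o
  obtain ⟨Φ₃, hΦ₃, hΦ₃z⟩ := exists_holAut_shear
    (v := fun z : EuclideanSpace ℂ (Fin n) => g (z o') • EuclideanSpace.single o (1 : ℂ))
    (by fun_prop) (fun z => by simp [hoo']) (fun z => by simp [hoo'])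
  refine ⟨Φ₃ * (Φ₂ * Φ₁), mul_mem hΦ₃ (mul_mem hΦ₂ hΦ₁), fun i => PiLp.ext fun a => ?_⟩
  simp only [Equiv.Perm.coe_mul, Function.comp_apply, hΦ₃z, h2 i o' hoo', hgi]
  by_cases ha : a = o
  · simp [ha]
  · simp [ha, h2 i a ha]

end Points

theorem exists_holAut_jetEq_of_injective {n k : ℕ} {ι : Type*} [Fintype ι] (hn : 2 ≤ n)
    (hk : 1 ≤ k) {x y : ι → EuclideanSpace ℂ (Fin n)} (hx : Function.Injective x)
    (hy : Function.Injective y) {g : ι → EuclideanSpace ℂ (Fin n) → EuclideanSpace ℂ (Fin n)}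
    (hg : ∀ i, ContDiff ℂ ω (g i)) (hgx : ∀ i, g i (x i) = y i)
    {L : ι → EuclideanSpace ℂ (Fin n) ≃L[ℂ] EuclideanSpace ℂ (Fin n)}
    (hL : ∀ i, HasFDerivAt (g i)
      (L i : EuclideanSpace ℂ (Fin n) →L[ℂ] EuclideanSpace ℂ (Fin n)) (x i)) :
    ∃ Φ ∈ holAut (EuclideanSpace ℂ (Fin n)), ∀ i, JetEq k Φ (g i) (x i) := by
  obtain ⟨s, hs⟩ : ∃ s : ι → ℂ, Function.Injective s :=
    ⟨fun i => ((Fintype.equivFin ι i : ℕ) : ℂ), fun i j h => by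
      simpa [Fin.val_inj] using h⟩
  let p : ι → EuclideanSpace ℂ (Fin n) := fun i => WithLp.toLp 2 fun _ => s i
  obtain ⟨Φ, hΦ, hΦx⟩ := exists_holAut_apply_eq hn hx hs
  obtain ⟨Ψ, hΨ, hΨy⟩ := exists_holAut_apply_eq hn hy hs
  have hΦp : ∀ i, Φ.symm (p i) = x i := fun i => by rw [Equiv.symm_apply_eq, hΦx]
  have hequiv : ∀ Θ ∈ holAut (EuclideanSpace ℂ (Fin n)), ∀ z,
      ∃ M : EuclideanSpace ℂ (Fin n) ≃L[ℂ] EuclideanSpace ℂ (Fin n),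
        HasFDerivAt Θ (M : EuclideanSpace ℂ (Fin n) →L[ℂ] EuclideanSpace ℂ (Fin n)) z := by
    intro Θ hΘ z
    have h1 := (differentiable_of_mem_holAut hΘ z).hasFDerivAt
    have h2 := (differentiable_of_mem_holAut (inv_mem hΘ) (Θ z)).hasFDerivAt
    have h3 := (differentiable_of_mem_holAut hΘ (Θ⁻¹ (Θ z))).hasFDerivAt
    have h4 := (h2.comp z h1).unique
      ((hasFDerivAt_id z).congr_of_eventuallyEq (Eventually.of_forall fun w => by simp))
    have h5 := (h3.comp (Θ z) h2).unique
      ((hasFDerivAt_id (Θ z)).congr_of_eventuallyEq (Eventually.of_forall fun w => by simp))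
    rw [show Θ⁻¹ (Θ z) = z from Θ.symm_apply_apply z] at h5
    exact ⟨ContinuousLinearEquiv.equivOfInverse _ _ (fun w => congrArg (· w) h4)
      (fun w => congrArg (· w) h5), h1⟩
  have hmodel : ∀ i, ∃ Θ ∈ localAut k {q | ∃ j, j ≠ i ∧ q = p j} (p i),
      JetEq k Θ (fun z => Ψ (g i (Φ.symm z))) (p i) := by
    intro i
    obtain ⟨M, hM⟩ := hequiv Φ⁻¹ (inv_mem hΦ) (p i)
    obtain ⟨M', hM'⟩ := hequiv Ψ hΨ (y i)
    refine exists_localAut_jetEq (L := (M.trans (L i)).trans M') hn hk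
      ((Set.finite_range p).subset ?_) ?_ (hΨ.1.comp ((hg i).comp hΦ.2)) ?_ ?_
    · rintro _ ⟨j, -, rfl⟩
      exact ⟨j, rfl⟩
    · rintro _ ⟨j, hj, rfl⟩ b
      simpa [p] using fun h => hj (hs h)
    · rw [hΦp, hgx, hΨy]
    · have h1 : HasFDerivAt (g i) (L i : EuclideanSpace ℂ (Fin n) →L[ℂ] _) (Φ⁻¹ (p i)) := by
        have := hL i
        rwa [← hΦp i] at this
      have h2 := h1.comp (p i) hM
      have h3 : HasFDerivAt Ψ (M' : EuclideanSpace ℂ (Fin n) →L[ℂ] _) ((g i ∘ Φ.symm) (p i)) := by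
        have : (g i ∘ Φ.symm) (p i) = y i := by
          rw [← hgx i, ← hΦp i]
          rfl
        rwa [this]
      exact h3.comp (p i) h2
  obtain ⟨Θ, hΘ, H⟩ := exists_holAut_jetEq hmodel
  refine ⟨Ψ⁻¹ * (Θ * Φ), mul_mem (inv_mem hΨ) (mul_mem hΘ hΦ), fun i => ?_⟩
  have hd := differentiable_of_mem_holAut hΦ
  have h1 := JetEq.comp_right (f := Θ) (g := fun z => Ψ (g i (Φ.symm z))) (Φ := Φ) (q := x i)
    (by rw [hΦx]; exact H i) (hd _)
  simp only [Equiv.symm_apply_apply] at h1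
  have h2 := h1.comp_left hΨ.2
    ((differentiable_of_mem_holAut hΘ).continuous.comp hd.continuous).continuousAt
    (hΨ.1.continuous.comp (hg i).continuous).continuousAt
  simp only [Equiv.symm_apply_apply] at h2
  exact h2

end JetInterpolation

/-- non-parametric jet interpolation (Forstnerič/Varolin) for `ℂⁿ`, n ≥ 2:
given distinct points `x̂ᵢ`, distinct images `yᵢ` and symmetric multilinear maps `A i j`
(degrees 1 ≤ j ≤ k) with invertible linear part, there is a holomorphic automorphism of
`ℂⁿ` with the prescribed values and iterated Fréchet derivatives. -/
theorem jet_interpolation_Cn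
    (n k N : ℕ) (hn : 2 ≤ n) (hk : 1 ≤ k) (hN : 1 ≤ N)
    (xh : Fin N → EuclideanSpace ℂ (Fin n)) (hxh : Function.Injective xh)
    (y : Fin N → EuclideanSpace ℂ (Fin n)) (hy : Function.Injective y)
    (A : Fin N → (j : ℕ) → ContinuousMultilinearMap ℂ
      (fun _ : Fin j => EuclideanSpace ℂ (Fin n)) (EuclideanSpace ℂ (Fin n)))
    (hAsymm : ∀ i (j : ℕ), 1 ≤ j → j ≤ k → ∀ (σ : Equiv.Perm (Fin j))
      (v : Fin j → EuclideanSpace ℂ (Fin n)), A i j (v ∘ σ) = A i j v)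
    (hA1 : ∀ i, Function.Bijective
      (fun v : EuclideanSpace ℂ (Fin n) => A i 1 (fun _ => v))) :
    ∃ F : EuclideanSpace ℂ (Fin n) → EuclideanSpace ℂ (Fin n),
      Differentiable ℂ F ∧
      (∃ G : EuclideanSpace ℂ (Fin n) → EuclideanSpace ℂ (Fin n),
        Differentiable ℂ G ∧ (∀ z, G (F z) = z) ∧ (∀ z, F (G z) = z)) ∧
      (∀ i, F (xh i) = y i) ∧
      (∀ i (j : ℕ), 1 ≤ j → j ≤ k → iteratedFDeriv ℂ j F (xh i) = A i j) := by
  choose g hg hgx hgA using fun i =>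
    JetInterpolation.exists_contDiff_iteratedFDeriv_eq k (xh i) (y i) (A i) (hAsymm i)
  have hL : ∀ i, ∃ L : EuclideanSpace ℂ (Fin n) ≃L[ℂ] EuclideanSpace ℂ (Fin n), HasFDerivAt (g i)
      (L : EuclideanSpace ℂ (Fin n) →L[ℂ] EuclideanSpace ℂ (Fin n)) (xh i) := by
    intro i
    have hd : HasFDerivAt (g i) (fderiv ℂ (g i) (xh i)) (xh i) :=
      ((hg i).differentiable (by simp) (xh i)).hasFDerivAt
    have hfun : ∀ v, fderiv ℂ (g i) (xh i) v = A i 1 fun _ => v := fun v => by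
      rw [← hgA i 1 le_rfl hk, iteratedFDeriv_one_apply]
    have hbij : Function.Bijective (fderiv ℂ (g i) (xh i)) := by
      have : ⇑(fderiv ℂ (g i) (xh i)) = fun v => A i 1 fun _ => v := funext hfun
      rw [this]
      exact hA1 i
    exact ⟨(LinearEquiv.ofBijective (fderiv ℂ (g i) (xh i)).toLinearMap
      hbij).toContinuousLinearEquiv, hd⟩
  choose L hL using hL
  obtain ⟨Φ, hΦ, H⟩ :=
    JetInterpolation.exists_holAut_jetEq_of_injective hn hk hxh hy hg hgx hL
  refine ⟨Φ, JetInterpolation.differentiable_of_mem_holAut hΦ, ⟨Φ.symm,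
    JetInterpolation.differentiable_of_mem_holAut (inv_mem hΦ), Φ.symm_apply_apply,
    Φ.apply_symm_apply⟩, fun i => by rw [(H i).apply_eq, hgx], fun i j hj hjk => ?_⟩
  rw [(H i).iteratedFDeriv_eq hΦ.1 (hg i) hjk, hgA i j hj hjk]
end

section
/- Let n ≥ 2 and N ≥ 1. For any two N-tuples (a_1, …, a_N) and (b_1, …, b_N) of points of ℂⁿ, each consisting of N pairwise distinct points, there exists a holomorphic automorphism F of ℂⁿ such that F(a_j) = b_j for all j = 1, …, N. -/
section Shear

variable {E : Type*} [NormedAddCommGroup E] [NormedSpace ℂ E]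

/-- The shear `z ↦ z + g (l z)`, where `g` takes values in the kernel of the functional `l`. -/
noncomputable def shear (l : E →L[ℂ] ℂ) (g : ℂ → E) (hg : ∀ t, l (g t) = 0) : E ≃ E where
  toFun z := z + g (l z)
  invFun z := z - g (l z)
  left_inv z := by simp [hg]
  right_inv z := by simp [hg]

/-- Vector-valued Lagrange interpolation inside the kernel of a continuous linear functional. -/
theorem exists_differentiable_interpolation {ι : Type*} [Fintype ι] (l : E →L[ℂ] ℂ)
    {x : ι → ℂ} (hx : Function.Injective x) {w : ι → E} (hw : ∀ j, l (w j) = 0) :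
    ∃ g : ℂ → E, Differentiable ℂ g ∧ (∀ t, l (g t) = 0) ∧ ∀ j, g (x j) = w j := by
  classical
  refine ⟨fun t ↦ ∑ i, (Lagrange.basis Finset.univ x i).eval t • w i, ?_, fun t ↦ ?_, fun j ↦ ?_⟩
  · exact Differentiable.fun_sum fun i _ ↦ (Polynomial.differentiable _).smul_const _
  · simp [hw]
  · beta_reduce
    rw [Finset.sum_eq_single j, Lagrange.eval_basis_self hx.injOn (Finset.mem_univ j), one_smul]
    · intro i _ hij
      rw [Lagrange.eval_basis_of_ne hij (Finset.mem_univ j), zero_smul]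
    · simp

/-- If `l` separates the points `a j`, some biholomorphic shear translates each `a j` by a
prescribed vector `w j` of the kernel of `l`. -/
theorem exists_shear_apply_eq_add {ι : Type*} [Fintype ι] (l : E →L[ℂ] ℂ) {a w : ι → E}
    (ha : Function.Injective fun j ↦ l (a j)) (hw : ∀ j, l (w j) = 0) :
    ∃ F : E ≃ E, Differentiable ℂ F ∧ Differentiable ℂ F.symm ∧ ∀ j, F (a j) = a j + w j := by
  obtain ⟨g, hgd, hg, hgw⟩ := exists_differentiable_interpolation l ha hw
  have hgl : Differentiable ℂ fun z ↦ g (l z) := hgd.comp l.differentiable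
  exact ⟨shear l g hg, differentiable_id.add hgl, differentiable_id.sub hgl,
    fun j ↦ congrArg (a j + ·) (hgw j)⟩

/-- If `l` separates the points `a j`, then a composition of two biholomorphic shears moves them
to prescribed distinct points `c j • v` of a line in the kernel of `l`. -/
theorem exists_biholomorphic_apply_eq_smul {ι : Type*} [Fintype ι] {l m : E →L[ℂ] ℂ} {v : E}
    (hl : l v = 0) (hm : m v = 1) {c : ι → ℂ} (hc : Function.Injective c) {a : ι → E}
    (ha : Function.Injective fun j ↦ l (a j)) :
    ∃ F : E ≃ E, Differentiable ℂ F ∧ Differentiable ℂ F.symm ∧ ∀ j, F (a j) = c j • v := by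
  obtain ⟨F, hF, hF', hFa⟩ := exists_shear_apply_eq_add (w := fun j ↦ (c j - m (a j)) • v) l ha
    (by simp [hl])
  have hmF (j : ι) : m (F (a j)) = c j := by simp [hFa, hm]
  obtain ⟨G, hG, hG', hGa⟩ := exists_shear_apply_eq_add (a := fun j ↦ F (a j))
    (w := fun j ↦ c j • v - F (a j)) m (by simpa only [hmF] using hc) (by simp [hmF, hm])
  exact ⟨F.trans G, hG.comp hF, hF'.comp hG', fun j ↦ by simp [hGa]⟩

end Shear

/-- Two finite families of distinct points are separated by a common linear functional. -/
theorem Module.exists_dual_injective_comp_pair {K M ι : Type*} [Field K] [Infinite K]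
    [AddCommGroup M] [Module K M] [Finite ι] {a b : ι → M}
    (ha : Function.Injective a) (hb : Function.Injective b) :
    ∃ f : Module.Dual K M,
      (Function.Injective fun j ↦ f (a j)) ∧ Function.Injective fun j ↦ f (b j) := by
  let d : {p : ι × ι // p.1 ≠ p.2} ⊕ {p : ι × ι // p.1 ≠ p.2} → M :=
    Sum.elim (fun p ↦ a p.1.1 - a p.1.2) (fun p ↦ b p.1.1 - b p.1.2)
  have hd : ∀ i, d i ≠ 0 := by
    rintro (⟨p, hp⟩ | ⟨p, hp⟩)
    · exact sub_ne_zero.2 (ha.ne hp)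
    · exact sub_ne_zero.2 (hb.ne hp)
  obtain ⟨f, hf⟩ := Module.exists_dual_forall_apply_ne_zero (K := K) d hd
  refine ⟨f, fun i j hij ↦ ?_, fun i j hij ↦ ?_⟩ <;> by_contra hne
  · exact hf (.inl ⟨(i, j), hne⟩) (by simpa [d, sub_eq_zero] using hij)
  · exact hf (.inr ⟨(i, j), hne⟩) (by simpa [d, sub_eq_zero] using hij)

/-- the action of `Aut(ℂⁿ)` on `ℂⁿ` (n ≥ 2) is `N`-transitive for every `N`
(Rosay–Rudin): any `N`-tuple of distinct points can be mapped onto any other `N`-tuple of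
distinct points by a holomorphic automorphism of `ℂⁿ`. -/
theorem aut_Cn_infinitely_transitive
    (n N : ℕ) (hn : 2 ≤ n) (hN : 1 ≤ N)
    (a b : Fin N → EuclideanSpace ℂ (Fin n))
    (ha : Function.Injective a) (hb : Function.Injective b) :
    ∃ F : EuclideanSpace ℂ (Fin n) → EuclideanSpace ℂ (Fin n),
      Differentiable ℂ F ∧
      (∃ G : EuclideanSpace ℂ (Fin n) → EuclideanSpace ℂ (Fin n),
        Differentiable ℂ G ∧ (∀ z, G (F z) = z) ∧ (∀ z, F (G z) = z)) ∧
      (∀ j, F (a j) = b j) := by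
  obtain ⟨f, hfa, hfb⟩ := Module.exists_dual_injective_comp_pair (K := ℂ) ha hb
  obtain ⟨v, hv, hv0⟩ := (LinearMap.ker f).ne_bot_iff.1
    (LinearMap.ker_ne_bot_of_finrank_lt (by simp; omega))
  obtain ⟨m, hm⟩ := SeparatingDual.exists_eq_one (R := ℂ) hv0
  have hc : Function.Injective fun j : Fin N ↦ ((j : ℕ) : ℂ) :=
    Nat.cast_injective.comp Fin.val_injective
  have hl : f.toContinuousLinearMap v = 0 := hv
  obtain ⟨A, hA, hA', hAa⟩ := exists_biholomorphic_apply_eq_smul hl hm hc (a := a) hfa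
  obtain ⟨B, hB, hB', hBb⟩ := exists_biholomorphic_apply_eq_smul hl hm hc (a := b) hfb
  exact ⟨A.trans B.symm, hB'.comp hA, ⟨(A.trans B.symm).symm, hA'.comp hB,
    Equiv.symm_apply_apply _, Equiv.apply_symm_apply _⟩,
    fun j ↦ by rw [Equiv.trans_apply, hAa, ← hBb, Equiv.symm_apply_apply]⟩
end

section
/- Let W = {w ∈ ℂ : |w − 1| < 1} be the open disc of radius 1 centered at 1, let M ≥ 1 be an integer, let g_1, …, g_M : W → ℂ be holomorphic functions with g_i(1) = 0 for all i, and assign each index i ∈ {1, …, M} as 'lower' or 'upper'. Set E_i(w) = [[1, 0], [g_i(w), 1]] if i is assigned 'lower' and E_i(w) = [[1, g_i(w)], [0, 1]] if i is assigned 'upper', and let P(w) = E_1(w) E_2(w) ⋯ E_M(w). Then there exists a holomorphic function f : W → ℂ such that the (2,2) entry of P(w) equals 1 + (w − 1)² f(w) for all w ∈ W. -/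
/-- The second column of a product of unipotent triangular matrices whose off-diagonal entries
are `(w - c) * h i w`: the upper entry is divisible by `w - c`, and the lower entry is congruent
to `1` modulo `(w - c) ^ 2`, with quotients differentiable wherever the `h i` are. -/
theorem exists_second_column_of_unipotent_product {s : Set ℂ} (c : ℂ) :
    ∀ {M : ℕ} (g h : Fin M → ℂ → ℂ) (lower : Fin M → Bool),
      (∀ i, DifferentiableOn ℂ (h i) s) → (∀ i w, g i w = (w - c) * h i w) →
      ∃ b f : ℂ → ℂ, DifferentiableOn ℂ b s ∧ DifferentiableOn ℂ f s ∧ ∀ w,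
        ((List.ofFn fun i : Fin M =>
            if lower i then !![(1 : ℂ), 0; g i w, 1] else !![(1 : ℂ), g i w; 0, 1]).prod) 0 1
          = (w - c) * b w ∧
        ((List.ofFn fun i : Fin M =>
            if lower i then !![(1 : ℂ), 0; g i w, 1] else !![(1 : ℂ), g i w; 0, 1]).prod) 1 1
          = 1 + (w - c) ^ 2 * f w := by
  intro M
  induction M with
  | zero =>
    intro g h lower _ _
    exact ⟨0, 0, differentiableOn_const 0, differentiableOn_const 0, fun w => by simp⟩
  | succ M ih =>
    intro g h lower hh hgh
    obtain ⟨b, f, hb, hf, hbf⟩ := ih (fun i => g i.succ) (fun i => h i.succ)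
      (fun i => lower i.succ) (fun i => hh i.succ) (fun i => hgh i.succ)
    have h0 := hh 0
    cases hl : lower 0 with
    | true =>
      refine ⟨b, fun w => h 0 w * b w + f w, hb, (h0.mul hb).add hf, fun w => ?_⟩
      obtain ⟨hbw, hfw⟩ := hbf w
      rw [List.ofFn_succ, List.prod_cons, Matrix.mul_apply, Matrix.mul_apply,
        Fin.sum_univ_two, Fin.sum_univ_two, hbw, hfw, hl, hgh]
      constructor <;> simp <;> ring
    | false =>
      refine ⟨fun w => b w + h 0 w * (1 + (w - c) ^ 2 * f w), f,
        hb.add (h0.mul (by fun_prop)), hf, fun w => ?_⟩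
      obtain ⟨hbw, hfw⟩ := hbf w
      rw [List.ofFn_succ, List.prod_cons, Matrix.mul_apply, Matrix.mul_apply,
        Fin.sum_univ_two, Fin.sum_univ_two, hbw, hfw, hl, hgh]
      constructor <;> simp <;> ring

/-- the key inductive claim in the counterexample of Section 1: for a product
`P(w)` of unipotent triangular matrix functions, holomorphic on the disc
`W = {|w - 1| < 1}` and all equal to the identity at `w = 1`, the `(2,2)` entry of `P(w)`
has the form `1 + (w - 1)² f(w)` with `f` holomorphic on `W`. Here `lower i = true` means
the `i`-th factor is unipotent lower triangular, otherwise unipotent upper triangular. -/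
theorem entry_two_two_of_product
    (M : ℕ) (hM : 1 ≤ M) (g : Fin M → ℂ → ℂ) (lower : Fin M → Bool)
    (hg : ∀ i, DifferentiableOn ℂ (g i) (Metric.ball (1 : ℂ) 1))
    (hg1 : ∀ i, g i 1 = 0) :
    ∃ f : ℂ → ℂ, DifferentiableOn ℂ f (Metric.ball (1 : ℂ) 1) ∧
      ∀ w ∈ Metric.ball (1 : ℂ) 1,
        ((List.ofFn fun i : Fin M =>
            if lower i then !![(1 : ℂ), 0; g i w, 1] else !![(1 : ℂ), g i w; 0, 1]).prod) 1 1
          = 1 + (w - 1) ^ 2 * f w := by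
  have hgh : ∀ i w, g i w = (w - 1) * dslope (g i) 1 w := fun i w => by
    simpa [hg1 i] using (sub_smul_dslope (g i) 1 w).symm
  obtain ⟨_, f, _, hf, hbf⟩ := exists_second_column_of_unipotent_product 1 g
    (fun i => dslope (g i) 1) lower
    (fun i => (Complex.differentiableOn_dslope (Metric.ball_mem_nhds 1 one_pos)).mpr (hg i)) hgh
  exact ⟨f, hf, fun w _ => (hbf w).2⟩
end

section
/- Let M ≥ 2 be an integer. Define ψ_M : ℂ^M → (2×2 complex matrices) by ψ_M(z_1, …, z_M) = E_1(z_1) E_2(z_2) ⋯ E_M(z_M), where E_i(c) = [[1, 0], [c, 1]] if i is odd and E_i(c) = [[1, c], [0, 1]] if i is even, and define Φ : ℂ^M → ℂ² by Φ(z) = (ψ_M(z)_{2,1}, ψ_M(z)_{2,2}), the last row of ψ_M(z). If z = (z_1, …, z_M) ∈ ℂ^M satisfies z_i ≠ 0 for some i ∈ {1, …, M−1}, then the Fréchet derivative over ℂ of Φ at z, as a ℂ-linear map ℂ^M → ℂ², is surjective. -/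
/-- The alternating product `ψ_M(z) = E₁(z₁) ⋯ E_M(z_M)` of unipotent triangular
matrices: the `(i.1+1)`-st factor is lower triangular for `i.1` even and upper
triangular for `i.1` odd. -/
noncomputable def psiM (M : ℕ) (z : EuclideanSpace ℂ (Fin M)) : Matrix (Fin 2) (Fin 2) ℂ :=
  (List.ofFn fun i : Fin M =>
    if i.1 % 2 = 0 then !![(1 : ℂ), 0; z i, 1] else !![(1 : ℂ), z i; 0, 1]).prod

/-- The last row `Φ = π ∘ ψ_M : ℂ^M → ℂ²` of `ψ_M`. -/
noncomputable def PhiM (M : ℕ) (z : EuclideanSpace ℂ (Fin M)) : ℂ × ℂ :=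
  (psiM M z 1 0, psiM M z 1 1)

/-- The last row of the alternating product of the first `n` unipotent factors with
parameters `y 0, …, y (n - 1)`, computed recursively. -/
noncomputable def lastRow (y : ℕ → ℂ) : ℕ → ℂ × ℂ
  | 0 => (0, 1)
  | n + 1 =>
    if n % 2 = 0 then ((lastRow y n).1 + (lastRow y n).2 * y n, (lastRow y n).2)
    else ((lastRow y n).1, (lastRow y n).1 * y n + (lastRow y n).2)

/-- The directional derivative of `lastRow` at `y` in the direction `v`. -/
noncomputable def lastRowDeriv (y v : ℕ → ℂ) : ℕ → ℂ × ℂ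
  | 0 => (0, 0)
  | n + 1 =>
    if n % 2 = 0 then
      ((lastRowDeriv y v n).1 + ((lastRowDeriv y v n).2 * y n + (lastRow y n).2 * v n),
        (lastRowDeriv y v n).2)
    else
      ((lastRowDeriv y v n).1,
        ((lastRowDeriv y v n).1 * y n + (lastRow y n).1 * v n) + (lastRowDeriv y v n).2)

/-- Extension of a finite vector by zero to a sequence. -/
noncomputable def extendZero {M : ℕ} (z : EuclideanSpace ℂ (Fin M)) (k : ℕ) : ℂ :=
  if h : k < M then z ⟨k, h⟩ else 0

lemma prod_ofFn_last_row (y : ℕ → ℂ) (n : ℕ) :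
    ((List.ofFn fun i : Fin n =>
      if i.1 % 2 = 0 then !![(1 : ℂ), 0; y i, 1] else !![(1 : ℂ), y i; 0, 1]).prod 1 0,
     (List.ofFn fun i : Fin n =>
      if i.1 % 2 = 0 then !![(1 : ℂ), 0; y i, 1] else !![(1 : ℂ), y i; 0, 1]).prod 1 1)
      = lastRow y n := by
  induction n with
  | zero => simp [lastRow]
  | succ n ih =>
    rw [Prod.ext_iff] at ih
    obtain ⟨h₀, h₁⟩ := ih
    simp only at h₀ h₁
    simp only [List.ofFn_succ', List.concat_eq_append, List.prod_append, List.prod_singleton,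
      Fin.val_castSucc, Fin.val_last, lastRow]
    split_ifs <;> simp [Matrix.mul_apply, Fin.sum_univ_two, h₀, h₁]

lemma PhiM_eq_lastRow {M : ℕ} (z : EuclideanSpace ℂ (Fin M)) :
    PhiM M z = lastRow (extendZero z) M := by
  rw [← prod_ofFn_last_row]
  simp [PhiM, psiM, extendZero]

lemma differentiable_lastRow_extendZero (M n : ℕ) :
    Differentiable ℂ fun z : EuclideanSpace ℂ (Fin M) => lastRow (extendZero z) n := by
  induction n with
  | zero => simp [lastRow]
  | succ n ih =>
    have hn : Differentiable ℂ fun z : EuclideanSpace ℂ (Fin M) => extendZero z n := by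
      unfold extendZero
      split_ifs <;> fun_prop
    simp only [lastRow]
    split_ifs <;> fun_prop

lemma hasDerivAt_lastRow (y v : ℕ → ℂ) (n : ℕ) :
    HasDerivAt (fun t : ℂ => lastRow (fun k => y k + t * v k) n) (lastRowDeriv y v n) 0 := by
  induction n with
  | zero => exact hasDerivAt_const _ _
  | succ n ih =>
    have h₁ : HasDerivAt (fun t : ℂ => (lastRow (fun k => y k + t * v k) n).1)
        (lastRowDeriv y v n).1 0 := ih.fst
    have h₂ : HasDerivAt (fun t : ℂ => (lastRow (fun k => y k + t * v k) n).2)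
        (lastRowDeriv y v n).2 0 := ih.snd
    have hv : HasDerivAt (fun t : ℂ => y n + t * v n) (v n) 0 := by
      simpa using ((hasDerivAt_id (0 : ℂ)).mul_const (v n)).const_add (y n)
    simp only [lastRow, lastRowDeriv]
    split_ifs
    · simpa using (h₁.add (h₂.mul hv)).prodMk h₂
    · simpa using h₁.prodMk ((h₁.mul hv).add h₂)

lemma fderiv_PhiM_apply {M : ℕ} (z v : EuclideanSpace ℂ (Fin M)) :
    fderiv ℂ (PhiM M) z v = lastRowDeriv (extendZero z) (extendZero v) M := by
  have hd : DifferentiableAt ℂ (PhiM M) z := by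
    rw [show PhiM M = fun z => lastRow (extendZero z) M from funext PhiM_eq_lastRow]
    exact differentiable_lastRow_extendZero M M z
  have hline := hd.hasFDerivAt.hasLineDerivAt v
  refine HasDerivAt.unique hline ?_
  have hcurve : (fun t : ℂ => PhiM M (z + t • v)) =
      fun t => lastRow (fun k => extendZero z k + t * extendZero v k) M := by
    funext t
    rw [PhiM_eq_lastRow]
    congr 1
    funext k
    unfold extendZero
    split_ifs <;> simp
  rw [hcurve]
  exact hasDerivAt_lastRow (extendZero z) (extendZero v) M

lemma lastRowDeriv_congr (y : ℕ → ℂ) {v w : ℕ → ℂ} {n : ℕ} (h : ∀ k < n, v k = w k) :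
    lastRowDeriv y v n = lastRowDeriv y w n := by
  induction n with
  | zero => rfl
  | succ n ih =>
    simp only [lastRowDeriv, ih fun k hk => h k (by omega), h n (by omega)]

lemma lastRow_of_eq_zero {y : ℕ → ℂ} {n : ℕ} (h : ∀ k < n, y k = 0) :
    lastRow y n = (0, 1) := by
  induction n with
  | zero => rfl
  | succ n ih => simp [lastRow, ih fun k hk => h k (by omega), h n (by omega)]

lemma lastRowDeriv_of_eq_zero {y v : ℕ → ℂ} {n : ℕ} (h : ∀ k < n + 1, y k = 0)
    (hv : ∀ k < n + 1, 0 < k → v k = 0) :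
    lastRowDeriv y v (n + 1) = (v 0, 0) := by
  induction n with
  | zero => simp [lastRowDeriv, lastRow]
  | succ n ih =>
    rw [lastRowDeriv, ih (fun k hk => h k (by omega)) fun k hk => hv k (by omega),
      h (n + 1) (by omega), hv (n + 1) (by omega) (by omega)]
    simp

lemma lastRowDeriv_surjective_of_eq_zero {y : ℕ → ℂ} {n : ℕ} (h : ∀ k < n, y k = 0)
    (hn : y n ≠ 0) : Function.Surjective fun v => lastRowDeriv y v (n + 2) := by
  rintro ⟨a, b⟩
  rcases n with _ | m
  · refine ⟨fun k => if k = 0 then a else (b - a * y 1) / y 0, ?_⟩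
    simp [lastRowDeriv, lastRow]
    field_simp
    ring
  · have hrow := lastRow_of_eq_zero h
    have hderiv (s t : ℂ) : lastRowDeriv y
        (fun k => if k = 0 then s else if k = m + 2 then t else 0) (m + 1) = (s, 0) := by
      rw [lastRowDeriv_of_eq_zero h]
      · simp
      · intro k hk hk0
        simp [hk0.ne', show k ≠ m + 2 by omega]
    rcases Nat.mod_two_eq_zero_or_one m with hm | hm
    · refine ⟨fun k => if k = 0 then b / y (m + 1) else if k = m + 2 then
        a - b / y (m + 1) - b * y (m + 2) else 0, ?_⟩
      simp only
      rw [lastRowDeriv, lastRowDeriv, hderiv, lastRow.eq_2 y (m + 1), hrow]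
      simp [show (m + 1) % 2 = 1 by omega, hm]
      field_simp
      simp
    · refine ⟨fun k => if k = 0 then a else if k = m + 2 then
        (b - a * y (m + 2)) / y (m + 1) else 0, ?_⟩
      simp only
      rw [lastRowDeriv, lastRowDeriv, hderiv, lastRow.eq_2 y (m + 1), hrow]
      simp [show (m + 1) % 2 = 0 by omega, hm]
      field_simp
      ring

lemma lastRowDeriv_surjective_succ {y : ℕ → ℂ} {n : ℕ}
    (h : Function.Surjective fun v => lastRowDeriv y v n) :
    Function.Surjective fun v => lastRowDeriv y v (n + 1) := by
  rintro ⟨a, b⟩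
  obtain ⟨v, hv⟩ := h (if n % 2 = 0 then (a - b * y n, b) else (a, b - a * y n))
  have hupdate : lastRowDeriv y (Function.update v n 0) n = lastRowDeriv y v n :=
    lastRowDeriv_congr y fun k hk => by simp [hk.ne]
  refine ⟨Function.update v n 0, ?_⟩
  simp only at hv ⊢
  rw [lastRowDeriv, hupdate, hv]
  split_ifs <;> simp

lemma lastRowDeriv_surjective {y : ℕ → ℂ} {n : ℕ} (h : ∃ k < n, y k ≠ 0) :
    Function.Surjective fun v => lastRowDeriv y v (n + 1) := by
  induction n with
  | zero => simp at h
  | succ n ih =>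
    by_cases hlt : ∃ k < n, y k ≠ 0
    · exact lastRowDeriv_surjective_succ (ih hlt)
    · push Not at hlt
      obtain ⟨k, hk, hyk⟩ := h
      obtain rfl : k = n := by
        by_contra hne
        exact hyk (hlt k (by omega))
      exact lastRowDeriv_surjective_of_eq_zero hlt hyk

/-- `Φ = π ∘ ψ_M` is a submersion outside
`S_M = {z : z₁ = … = z_{M-1} = 0}`: if some `z i ≠ 0` with `i.1 < M - 1` (i.e. one of
the first `M - 1` coordinates is nonzero), then the Fréchet derivative of `Φ` at `z` is
surjective. -/
theorem psi_last_row_submersion_outside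
    (M : ℕ) (hM : 2 ≤ M) (z : EuclideanSpace ℂ (Fin M))
    (hz : ∃ i : Fin M, i.1 < M - 1 ∧ z i ≠ 0) :
    Function.Surjective (fderiv ℂ (PhiM M) z) := by
  obtain ⟨m, rfl⟩ : ∃ m, M = m + 1 := ⟨M - 1, by omega⟩
  obtain ⟨i, hi, hzi⟩ := hz
  intro p
  obtain ⟨v, hv⟩ := lastRowDeriv_surjective (y := extendZero z) (n := m)
    ⟨i, by omega, by simpa [extendZero, i.2] using hzi⟩ p
  refine ⟨WithLp.toLp 2 fun k => v k, ?_⟩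
  rw [fderiv_PhiM_apply, ← hv]
  exact lastRowDeriv_congr _ fun k hk => by simp [extendZero, hk]
end

section
/- Let n ≥ 2 and let (a_k)_{k ∈ ℕ} be an injective sequence of nonzero points of ℂⁿ whose image {a_k : k ∈ ℕ} is a closed and discrete subset of ℂⁿ, and suppose that ∑_{k} 1/‖a_k‖^{2n−2} < ∞, where ‖·‖ is the Euclidean norm on ℂⁿ. Then the sequence (a_k) is tame: there exists a holomorphic automorphism F of ℂⁿ such that F(a_k) = (k, 0, …, 0) for all k ∈ ℕ. -/
open Filter Topology MeasureTheory

/-- In a normed space, a point off a finite set carries a `C¹` function with prescribed value there,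
vanishing on the finite set, and with small derivative on a ball about the origin. -/
theorem exists_contDiff_eq_of_notMem_finset
    {E F : Type*} [NormedAddCommGroup E] [NormedSpace ℂ E] [ProperSpace E]
    [NormedAddCommGroup F] [NormedSpace ℂ F]
    (s : Finset E) (b : E) (hb : b ∉ s) (c : F) {ε : ℝ} (hε : 0 < ε) :
    ∃ f : E → F, ContDiff ℂ 1 f ∧ f b = c ∧ (∀ x ∈ s, f x = 0) ∧
      ∀ x, ‖x‖ < ‖b‖ / 2 → ‖fderiv ℂ f x‖ ≤ ε := by
  have separating : ∀ y : s, ∃ l : StrongDual ℂ E, l b - l y ≠ 0 := fun y => by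
    have hy : ‖b - y‖ ≠ 0 := norm_ne_zero_iff.mpr (sub_ne_zero.mpr fun h => hb (h ▸ y.2))
    obtain ⟨l, -, hl⟩ := exists_dual_vector ℂ (b - (y : E)) hy
    exact ⟨l, by rw [← map_sub, hl]; exact Complex.ofReal_ne_zero.mpr hy⟩
  choose l hl using separating
  obtain ⟨q, hq, hqb, hqs⟩ : ∃ q : E → F, ContDiff ℂ 1 q ∧ q b = c ∧ ∀ x ∈ s, q x = 0 := by
    refine ⟨fun x => (∏ y : s, (l y x - l y y) / (l y b - l y y)) • c, ?_, ?_, ?_⟩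
    · exact (contDiff_prod fun y _ =>
        (((l y).contDiff.sub contDiff_const).div_const _)).smul contDiff_const
    · simp [div_self (hl _)]
    · intro x hx
      beta_reduce
      rw [Finset.prod_eq_zero (Finset.mem_univ (⟨x, hx⟩ : s)) (by rw [sub_self, zero_div]),
        zero_smul]
  rcases eq_or_ne b 0 with rfl | hb0
  · refine ⟨q, hq, hqb, hqs, fun x hx => ?_⟩
    simp only [norm_zero, zero_div] at hx
    exact absurd hx (norm_nonneg x).not_gt
  have hbpos : 0 < ‖b‖ := norm_pos_iff.mpr hb0
  obtain ⟨p, hp1, hpb⟩ := exists_dual_vector ℂ b hbpos.ne'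
  set m : StrongDual ℂ E := (‖b‖ : ℂ)⁻¹ • p with hm
  have hmb : m b = 1 := by
    have : (‖b‖ : ℂ) ≠ 0 := by exact_mod_cast hbpos.ne'
    simp [hm, hpb, this]
  have hmx : ∀ x, ‖x‖ < ‖b‖ / 2 → ‖m x‖ ≤ 1 / 2 := fun x hx => by
    have h1 : ‖p x‖ ≤ ‖x‖ := by simpa [hp1] using p.le_opNorm x
    have h2 : ‖m x‖ = ‖b‖⁻¹ * ‖p x‖ := by simp [hm]
    rw [h2, inv_mul_le_iff₀ hbpos]
    linarith
  obtain ⟨A, hA⟩ := (isCompact_closedBall (0 : E) (‖b‖ / 2)).exists_bound_of_continuousOn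
    hq.continuous.continuousOn
  obtain ⟨B, hB⟩ := (isCompact_closedBall (0 : E) (‖b‖ / 2)).exists_bound_of_continuousOn
    (hq.continuous_fderiv one_ne_zero).continuousOn
  have hlim : Tendsto (fun N : ℕ => (1 / 2 : ℝ) ^ N * (1 / 2) * B +
      ((N : ℝ) * (1 / 2 : ℝ) ^ N + (1 / 2) ^ N) * ‖m‖ * A) atTop (𝓝 0) := by
    have h1 := tendsto_pow_atTop_nhds_zero_of_lt_one (r := (1 / 2 : ℝ)) (by norm_num) (by norm_num)
    have h2 := tendsto_self_mul_const_pow_of_lt_one (r := (1 / 2 : ℝ)) (by norm_num) (by norm_num)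
    simpa only [zero_mul, add_zero] using ((h1.mul_const (1 / 2)).mul_const B).add
      (((h2.add h1).mul_const ‖m‖).mul_const A)
  obtain ⟨N, hN⟩ := (hlim.eventually_le_const hε).exists
  refine ⟨fun x => m x ^ (N + 1) • q x, (m.contDiff.pow _).smul hq, by simp [hmb, hqb],
    fun x hx => by simp [hqs x hx], fun x hx => le_trans ?_ hN⟩
  have hder := ((m.hasFDerivAt (x := x)).pow (N + 1)).smul
    (hq.differentiable one_ne_zero x).hasFDerivAt
  have hxmem : x ∈ Metric.closedBall (0 : E) (‖b‖ / 2) := by simpa using hx.le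
  have hmN : ‖m x‖ ^ N ≤ (1 / 2) ^ N := pow_le_pow_left₀ (norm_nonneg _) (hmx x hx) N
  have hmN1 : ‖m x‖ ^ (N + 1) ≤ (1 / 2) ^ N * (1 / 2) := by
    rw [← pow_succ]; exact pow_le_pow_left₀ (norm_nonneg _) (hmx x hx) _
  have hA0 : 0 ≤ A := (norm_nonneg _).trans (hA x hxmem)
  rw [show fderiv ℂ (fun x => m x ^ (N + 1) • q x) x = _ from hder.fderiv]
  refine (norm_add_le _ _).trans (add_le_add ?_ ?_)
  · rw [norm_smul, norm_pow]
    exact mul_le_mul hmN1 (hB x hxmem) (norm_nonneg _) (by positivity)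
  · rw [ContinuousLinearMap.norm_smulRight_apply, norm_smul]
    refine mul_le_mul (mul_le_mul_of_nonneg_right ?_ (norm_nonneg _)) (hA x hxmem)
      (norm_nonneg _) (by positivity)
    simp only [add_tsub_cancel_right, nsmul_eq_mul, norm_mul, norm_pow, Complex.norm_natCast]
    push_cast
    nlinarith [mul_le_mul_of_nonneg_left hmN (by positivity : (0 : ℝ) ≤ (N : ℝ) + 1)]

/-- Interpolation by entire maps: values at a sequence of distinct points tending to infinity
can be prescribed arbitrarily. -/
theorem exists_differentiable_interpolation_s13
    {E F : Type*} [NormedAddCommGroup E] [NormedSpace ℂ E] [ProperSpace E]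
    [NormedAddCommGroup F] [NormedSpace ℂ F] [CompleteSpace F]
    (b : ℕ → E) (hinj : Function.Injective b) (hb : Tendsto (fun k => ‖b k‖) atTop atTop)
    (c : ℕ → F) : ∃ f : E → F, Differentiable ℂ f ∧ ∀ k, f (b k) = c k := by
  classical
  have correction := fun (k : ℕ) (d : F) =>
    exists_contDiff_eq_of_notMem_finset ((Finset.range k).image b) (b k)
      (by simpa using fun j hj h => hj.ne (hinj h)) d
      (ε := (1 / 2 : ℝ) ^ k) (by positivity)
  choose T hTdiff hTval hTzero hTbound using correction
  let S : ℕ → E → F := fun k => Nat.rec 0 (fun k g => g + T k (c k - g (b k))) k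
  let f : ℕ → E → F := fun k => T k (c k - S k (b k))
  have hS : ∀ k, S (k + 1) = S k + f k := fun _ => rfl
  have hSsum : ∀ k x, S k x = ∑ j ∈ Finset.range k, f j x := by
    intro k x
    induction k with
    | zero => rfl
    | succ k ih => rw [hS, Pi.add_apply, ih, Finset.sum_range_succ]
  have hfzero : ∀ j k, j < k → f k (b j) = 0 := fun j k hjk =>
    hTzero k _ _ (Finset.mem_image_of_mem b (Finset.mem_range.mpr hjk))
  refine ⟨fun x => ∑' k, f k x, fun x => ?_, fun k => ?_⟩
  · set R : ℝ := ‖x‖ + ‖b 0‖ + 1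
    have hbound : ∀ k, ∃ M, ∀ y ∈ Metric.ball (0 : E) R, ‖fderiv ℂ (f k) y‖ ≤ M := fun k => by
      obtain ⟨M, hM⟩ := (isCompact_closedBall (0 : E) R).exists_bound_of_continuousOn
        ((hTdiff k (c k - S k (b k))).continuous_fderiv one_ne_zero).continuousOn
      exact ⟨M, fun y hy => hM y (Metric.ball_subset_closedBall hy)⟩
    choose M hM using hbound
    let u : ℕ → ℝ := fun k => if 2 * R ≤ ‖b k‖ then (1 / 2) ^ k else M k
    have hu : Summable u := by
      refine (summable_geometric_of_lt_one (r := (1 / 2 : ℝ)) (by norm_num)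
        (by norm_num)).congr_atTop ?_
      filter_upwards [hb.eventually_ge_atTop (2 * R)] with k hk
      simp [u, hk]
    refine (hasFDerivAt_tsum_of_isPreconnected (f' := fun k y => fderiv ℂ (f k) y)
      hu Metric.isOpen_ball (convex_ball (0 : E) R).isPreconnected
      (fun k y _ => ((hTdiff k _).differentiable one_ne_zero y).hasFDerivAt)
      (fun k y hy => ?_) (x₀ := b 0) ?_ ?_ ?_).differentiableAt
    · by_cases h : 2 * R ≤ ‖b k‖
      · simp only [u, h, if_true]
        refine hTbound k _ y ?_
        have : ‖y‖ < R := by simpa using hy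
        linarith
      · simpa only [u, h, if_false] using hM k y hy
    · simp only [Metric.mem_ball, dist_zero_right, R]
      linarith [norm_nonneg x]
    · exact summable_of_ne_finset_zero (s := {0}) fun k hk =>
        hfzero 0 k (Nat.pos_of_ne_zero (by simpa using hk))
    · simp only [Metric.mem_ball, dist_zero_right, R]
      linarith [norm_nonneg (b 0)]
  · change ∑' j, f j (b k) = c k
    rw [tsum_eq_sum (s := Finset.range (k + 1))
      fun j hj => hfzero k j (by simpa [Nat.succ_le_iff] using hj), ← hSsum, hS, Pi.add_apply]
    simp [f, hTval]

/-- Under the summability condition, some linear projection along a line is injective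
and proper on the sequence. -/
theorem exists_projection_injective_tendsto_norm
    {F : Type*} [NormedAddCommGroup F] [NormedSpace ℂ F] [FiniteDimensional ℂ F] [Nontrivial F]
    (a : ℕ → F × ℂ) (hinj : Function.Injective a) (hne : ∀ k, a k ≠ 0)
    (hsum : Summable fun k => 1 / ‖a k‖ ^ Module.finrank ℝ F) :
    ∃ w : F, (Function.Injective fun k => (a k).1 - (a k).2 • w) ∧
      Tendsto (fun k => ‖(a k).1 - (a k).2 • w‖) atTop atTop := by
  borelize F
  have : FiniteDimensional ℝ F := FiniteDimensional.complexToReal F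
  let μ : Measure F := Measure.addHaar
  let B : Set F := Metric.ball 0 1
  have hBpos : μ B ≠ 0 := (Metric.measure_ball_pos μ 0 one_pos).ne'
  let bad : ℕ → ℕ → Set F := fun R k => {w | ‖w‖ < 1 ∧ ‖(a k).1 - (a k).2 • w‖ ≤ R}
  have hbad : ∀ R k, ∃ z, bad R k ⊆ Metric.closedBall z (2 * R / ‖a k‖) := by
    intro R k
    have hpos : 0 < ‖a k‖ := norm_pos_iff.mpr (hne k)
    rcases le_or_gt ‖a k‖ (2 * R) with hle | hgt
    · refine ⟨0, fun w hw => ?_⟩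
      rw [mem_closedBall_zero_iff]
      exact hw.1.le.trans ((one_le_div hpos).mpr hle)
    · refine ⟨(a k).2⁻¹ • (a k).1, fun w hw => ?_⟩
      obtain ⟨hw1, hwR⟩ := hw
      have hsmul : ‖(a k).2 • w‖ ≤ ‖(a k).2‖ := by
        rw [norm_smul]; exact mul_le_of_le_one_right (norm_nonneg _) hw1.le
      have htri := norm_sub_norm_le (a k).1 ((a k).2 • w)
      have ht : ‖a k‖ / 2 < ‖(a k).2‖ := by
        by_contra! h
        have hmax : ‖a k‖ = max ‖(a k).1‖ ‖(a k).2‖ := Prod.norm_def _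
        rcases max_choice ‖(a k).1‖ ‖(a k).2‖ with h' | h' <;> rw [h'] at hmax <;> linarith
      have ht0 : 0 < ‖(a k).2‖ := by linarith
      have heq : w - (a k).2⁻¹ • (a k).1 = -((a k).2⁻¹ • ((a k).1 - (a k).2 • w)) := by
        rw [smul_sub, inv_smul_smul₀ (norm_pos_iff.mp ht0)]; abel
      rw [mem_closedBall_iff_norm, heq, norm_neg, norm_smul, norm_inv, inv_mul_le_iff₀ ht0,
        ← mul_div_assoc, le_div_iff₀ hpos]
      nlinarith [Nat.cast_nonneg (α := ℝ) R]
  have hproper : ∀ᵐ w ∂μ, ∀ R : ℕ, ∀ᶠ k in atTop, w ∉ bad R k := by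
    refine ae_all_iff.mpr fun R => ae_eventually_notMem (ne_top_of_le_ne_top ?_
      (ENNReal.tsum_le_tsum (g := fun k =>
        ENNReal.ofReal ((2 * R / ‖a k‖) ^ Module.finrank ℝ F) * μ B) fun k => ?_))
    · rw [ENNReal.tsum_mul_right]
      refine ENNReal.mul_ne_top (Summable.tsum_ofReal_ne_top ?_)
        Metric.isBounded_ball.measure_lt_top.ne
      simpa only [div_pow, mul_one_div] using hsum.mul_left ((2 * R : ℝ) ^ Module.finrank ℝ F)
    · obtain ⟨z, hz⟩ := hbad R k
      rw [← Measure.addHaar_closedBall μ z (by positivity)]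
      exact measure_mono hz
  have hsep : ∀ᵐ w ∂μ, ∀ j k, j ≠ k → (a j).1 - (a j).2 • w ≠ (a k).1 - (a k).2 • w := by
    refine ae_all_iff.mpr fun j => ae_all_iff.mpr fun k => ?_
    by_cases hjk : j = k
    · simp [hjk]
    refine measure_mono_null (t := {((a j).2 - (a k).2)⁻¹ • ((a j).1 - (a k).1)}) ?_
      (measure_singleton _)
    intro w hw
    have hw' : (a j).1 - (a j).2 • w = (a k).1 - (a k).2 • w := by
      by_contra h
      exact hw fun _ => h
    have hdiff : (a j).1 - (a k).1 = ((a j).2 - (a k).2) • w := by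
      rw [sub_smul, sub_eq_sub_iff_sub_eq_sub, hw']
    have ht : (a j).2 - (a k).2 ≠ 0 := fun h => by
      rw [h, zero_smul] at hdiff
      exact hjk (hinj (Prod.ext (sub_eq_zero.mp hdiff) (sub_eq_zero.mp h)))
    rw [Set.mem_singleton_iff, hdiff, inv_smul_smul₀ ht]
  obtain ⟨w, hwB, hwR, hwinj⟩ := Measure.exists_mem_of_measure_ne_zero_of_ae hBpos
    (ae_restrict_of_ae (hproper.and hsep))
  refine ⟨w, fun j k h => by_contra fun hjk => hwinj j k hjk h, tendsto_atTop.mpr fun r => ?_⟩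
  obtain ⟨R, hR⟩ := exists_nat_ge r
  filter_upwards [hwR R] with k hk
  by_contra! h
  exact hk ⟨by simpa [B] using hwB, h.le.trans hR⟩

/-- A sequence in `F × ℂ` satisfying the summability condition is mapped onto `(0, k)` by an
automorphism composed of shears. -/
theorem exists_automorphism_prod
    {F : Type*} [NormedAddCommGroup F] [NormedSpace ℂ F] [FiniteDimensional ℂ F] [Nontrivial F]
    (a : ℕ → F × ℂ) (hinj : Function.Injective a) (hne : ∀ k, a k ≠ 0)
    (hsum : Summable fun k => 1 / ‖a k‖ ^ Module.finrank ℝ F) :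
    ∃ Φ Ψ : F × ℂ → F × ℂ, Differentiable ℂ Φ ∧ Differentiable ℂ Ψ ∧
      (∀ z, Ψ (Φ z) = z) ∧ (∀ z, Φ (Ψ z) = z) ∧ ∀ k : ℕ, Φ (a k) = (0, (k : ℂ)) := by
  have : ProperSpace F := FiniteDimensional.proper ℂ F
  obtain ⟨w, hbinj, hb⟩ := exists_projection_injective_tendsto_norm a hinj hne hsum
  obtain ⟨g, hg, hgval⟩ := exists_differentiable_interpolation_s13 _ hbinj hb
    fun k => (k : ℂ) - (a k).2
  obtain ⟨h, hh, hhval⟩ := exists_differentiable_interpolation_s13 (fun k : ℕ => (k : ℂ))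
    Nat.cast_injective (by simpa using tendsto_natCast_atTop_atTop)
    fun k => (a k).1 - (a k).2 • w
  refine ⟨fun z => (z.1 - z.2 • w - h (z.2 + g (z.1 - z.2 • w)), z.2 + g (z.1 - z.2 • w)),
    fun z => (z.1 + h z.2 + (z.2 - g (z.1 + h z.2)) • w, z.2 - g (z.1 + h z.2)),
    by fun_prop, by fun_prop, fun z => by simp, fun z => by simp, fun k => ?_⟩
  simp only [hgval, add_sub_cancel, hhval, sub_self]

/-- Splitting off the first coordinate of `ℂᵐ⁺¹`. -/
noncomputable def euclideanTailHead (m : ℕ) :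
    EuclideanSpace ℂ (Fin (m + 1)) ≃L[ℂ] (Fin m → ℂ) × ℂ :=
  LinearEquiv.toContinuousLinearEquiv
    { toFun := fun x => (fun i => x i.succ, x 0)
      invFun := fun p => WithLp.toLp 2 (Fin.cons p.2 p.1)
      map_add' := fun _ _ => rfl
      map_smul' := fun _ _ => rfl
      left_inv := fun x => by
        ext i
        refine Fin.cases ?_ (fun i => ?_) i <;> simp
      right_inv := fun p => by simp }

theorem euclideanTailHead_single (m : ℕ) (c : ℂ) :
    euclideanTailHead m (EuclideanSpace.single 0 c) = (0, c) := by
  refine Prod.ext (funext fun i => ?_) ?_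
  · change (EuclideanSpace.single (0 : Fin (m + 1)) c) i.succ = 0
    simp
  · change (EuclideanSpace.single (0 : Fin (m + 1)) c) 0 = c
    simp

/-- Winkelmann's tameness criterion: a closed discrete injective sequence
`(a_k)` of nonzero points of `ℂⁿ` (n ≥ 2) with `∑ 1/‖a_k‖^{2n-2} < ∞` (Euclidean norm) is
tame, i.e. some holomorphic automorphism `F` of `ℂⁿ` satisfies `F(a_k) = (k, 0, …, 0)`
for all `k`. -/
theorem winkelmann_tame
    (n : ℕ) (hn : 2 ≤ n)
    (a : ℕ → EuclideanSpace ℂ (Fin n))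
    (ha_inj : Function.Injective a)
    (ha_ne : ∀ k, a k ≠ 0)
    (ha_closed : IsClosed (Set.range a))
    (ha_discrete : DiscreteTopology (Set.range a))
    (hsum : Summable fun k : ℕ => 1 / ‖a k‖ ^ (2 * n - 2)) :
    ∃ F : EuclideanSpace ℂ (Fin n) → EuclideanSpace ℂ (Fin n),
      Differentiable ℂ F ∧
      (∃ G : EuclideanSpace ℂ (Fin n) → EuclideanSpace ℂ (Fin n),
        Differentiable ℂ G ∧ (∀ z, G (F z) = z) ∧ (∀ z, F (G z) = z)) ∧
      (∀ k : ℕ, F (a k) = EuclideanSpace.single (⟨0, by omega⟩ : Fin n) (k : ℂ)) := by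

  obtain ⟨m, rfl⟩ : ∃ m, n = m + 1 := ⟨n - 1, by omega⟩
  have : Nonempty (Fin m) := ⟨⟨0, by omega⟩⟩
  let L := euclideanTailHead m
  have hrank : Module.finrank ℝ (Fin m → ℂ) = 2 * (m + 1) - 2 := by
    rw [finrank_real_of_complex, Module.finrank_fin_fun]
    omega
  have hLne : ∀ k, L (a k) ≠ 0 := fun k => by simpa using ha_ne k
  have hLsum : Summable fun k => 1 / ‖L (a k)‖ ^ Module.finrank ℝ (Fin m → ℂ) := by
    rw [hrank]
    set C : ℝ := ‖(L.symm : (Fin m → ℂ) × ℂ →L[ℂ] EuclideanSpace ℂ (Fin (m + 1)))‖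
    refine Summable.of_nonneg_of_le (fun k => by positivity) (fun k => ?_)
      (hsum.mul_left (C ^ (2 * (m + 1) - 2)))
    have hle : ‖a k‖ ≤ C * ‖L (a k)‖ := by
      simpa using (L.symm : (Fin m → ℂ) × ℂ →L[ℂ] EuclideanSpace ℂ (Fin (m + 1))).le_opNorm
        (L (a k))
    have hapos : 0 < ‖a k‖ := norm_pos_iff.mpr (ha_ne k)
    have hLpos : 0 < ‖L (a k)‖ := norm_pos_iff.mpr (hLne k)
    rw [mul_one_div, div_le_div_iff₀ (by positivity) (by positivity), one_mul, ← mul_pow]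
    exact pow_le_pow_left₀ hapos.le hle _
  obtain ⟨Φ, Ψ, hΦ, hΨ, hΨΦ, hΦΨ, hval⟩ :=
    exists_automorphism_prod (fun k => L (a k)) (L.injective.comp ha_inj) hLne hLsum
  refine ⟨fun z => L.symm (Φ (L z)), L.symm.differentiable.comp (hΦ.comp L.differentiable),
    ⟨fun z => L.symm (Ψ (L z)), L.symm.differentiable.comp (hΨ.comp L.differentiable),
      fun z => by simp [hΨΦ], fun z => by simp [hΦΨ]⟩, fun k => ?_⟩
  beta_reduce
  rw [hval, ContinuousLinearEquiv.symm_apply_eq]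
  exact (euclideanTailHead_single m k).symm
end
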